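/- arXiv:0902.3013 — 8 statements merged into one kernel-verified Lean document; each statement's English description precedes it below -/
import Mathlib

section
/- Let A be a commutative noetherian ring, F a flat A-module, and E an injective cogenerator of the category of A-modules. Then the canonical evaluation map α : F → Hom_A(Hom_A(F, E), E) fits into a short exact sequence 0 → F → Hom_A(Hom_A(F, E), E) → F' → 0 in which α is a pure monomorphism, the middle module Hom_A(Hom_A(F, E), E) is cotorsion flat, and the cokernel F' is a flat A-module. -/
universe u

/-- An `A`-module `C` is *cotorsion* if `Ext¹_A(F, C) = 0` for every flat `A`-module `F`. -/
def IsCotorsion (A : Type u) [CommRing A] (C : Type u) [AddCommGroup C] [Module A C] : Prop :=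
  ∀ (F : Type u) [AddCommGroup F] [Module A F], Module.Flat A F →
    Subsingleton (((Ext A (ModuleCat.{u} A) 1).obj
      (Opposite.op (ModuleCat.of A F))).obj (ModuleCat.of A C))

/-- An `A`-module is *cotorsion flat* if it is both cotorsion and flat. -/
def IsCotorsionFlat (A : Type u) [CommRing A] (C : Type u) [AddCommGroup C] [Module A C] : Prop :=
  IsCotorsion A C ∧ Module.Flat A C

/-- `E` is an injective cogenerator of the category of `A`-modules. -/
def IsInjectiveCogenerator (A : Type u) [CommRing A] (E : Type u) [AddCommGroup E]
    [Module A E] : Prop :=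
  Module.Injective A E ∧
    ∀ (M : Type u) [AddCommGroup M] [Module A M], (∀ f : M →ₗ[A] E, f = 0) → Subsingleton M

/-- The canonical evaluation map `F → Hom_A(Hom_A(F, E), E)`, `x ↦ (g ↦ g x)`. -/
noncomputable def evalMap (A : Type u) [CommRing A] (F E : Type u) [AddCommGroup F] [Module A F]
    [AddCommGroup E] [Module A E] : F →ₗ[A] ((F →ₗ[A] E) →ₗ[A] E) :=
  (LinearMap.id : (F →ₗ[A] E) →ₗ[A] (F →ₗ[A] E)).flip

open TensorProduct CategoryTheory

section aux
variable {A : Type u} [CommRing A]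

lemma aux_factor {E M N : Type u} [AddCommGroup E] [Module A E] [AddCommGroup M] [Module A M]
    [AddCommGroup N] [Module A N] (hE : Module.Injective A E) (f : M →ₗ[A] N) (g : M →ₗ[A] E)
    (h : ∀ x, f x = 0 → g x = 0) : ∃ k : N →ₗ[A] E, ∀ x, k (f x) = g x := by
  obtain ⟨k, hk⟩ := Module.Injective.extension_property A E _ _
    ((LinearMap.ker f).liftQ f le_rfl)
    (LinearMap.ker_eq_bot.1 (Submodule.ker_liftQ_eq_bot' _ _ rfl))
    ((LinearMap.ker f).liftQ g (fun x hx => LinearMap.mem_ker.2 (h x (LinearMap.mem_ker.1 hx))))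
  refine ⟨k, fun x => ?_⟩
  have := LinearMap.congr_fun hk (Submodule.Quotient.mk x)
  rw [LinearMap.comp_apply, Submodule.liftQ_apply, Submodule.liftQ_apply] at this
  exact this

lemma aux_sep {E M : Type u} [AddCommGroup E] [Module A E] [AddCommGroup M] [Module A M]
    (hE : IsInjectiveCogenerator A E) (z : M) (h : ∀ f : M →ₗ[A] E, f z = 0) : z = 0 := by
  have : Subsingleton (A ∙ z) := by
    apply hE.2
    intro f
    obtain ⟨k, hk⟩ := aux_factor hE.1 (A ∙ z).subtype f (by
      intro x hx
      have : x = 0 := Subtype.ext hx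
      simp [this])
    ext ⟨x, hx⟩
    rw [← hk]
    obtain ⟨a, rfl⟩ := Submodule.mem_span_singleton.1 hx
    simp [h k]
  have h2 : (⟨z, Submodule.mem_span_singleton_self z⟩ : A ∙ z) = 0 := Subsingleton.elim _ _
  exact congrArg Subtype.val h2

lemma aux_dual_injective {E M : Type u} [AddCommGroup E] [Module A E] [AddCommGroup M] [Module A M]
    (hE : Module.Injective A E) (hM : Module.Flat A M) : Module.Injective A (M →ₗ[A] E) := by
  constructor
  intro X Y _ _ _ _ f hf g
  obtain ⟨k, hk⟩ := aux_factor hE (LinearMap.rTensor M f) (TensorProduct.lift g) (by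
    intro x hx
    have : x = 0 := Module.Flat.rTensor_preserves_injective_linearMap f hf (by simpa using hx)
    simp [this])
  refine ⟨TensorProduct.curry k, fun x => ?_⟩
  ext m
  simpa using hk (x ⊗ₜ m)

lemma aux_flat_of_dual_injective {E M : Type u} [AddCommGroup E] [Module A E] [AddCommGroup M]
    [Module A M] (hE : IsInjectiveCogenerator A E) (h : Module.Injective A (M →ₗ[A] E)) :
    Module.Flat A M := by
  rw [Module.Flat.iff_rTensor_injective']
  intro I
  rw [injective_iff_map_eq_zero]
  intro z hz
  refine aux_sep hE z fun f => ?_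
  obtain ⟨k, hk⟩ := h.out I.subtype Subtype.val_injective (TensorProduct.curry f)
  have : f = TensorProduct.lift k ∘ₗ LinearMap.rTensor M I.subtype := by
    ext x m
    simpa using (LinearMap.congr_fun (hk x) m).symm
  rw [this, LinearMap.comp_apply, hz, map_zero]

lemma aux_pure {E F : Type u} [AddCommGroup E] [Module A E] [AddCommGroup F]
    [Module A F] (hE : IsInjectiveCogenerator A E) (L : Type u) [AddCommGroup L] [Module A L] :
    Function.Injective (LinearMap.rTensor L (evalMap A F E)) := by
  rw [injective_iff_map_eq_zero]
  intro z hz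
  refine aux_sep hE z fun f => ?_
  let g : ((F →ₗ[A] E) →ₗ[A] E) ⊗[A] L →ₗ[A] E :=
    TensorProduct.lift (LinearMap.flip
      (LinearMap.llcomp A L (F →ₗ[A] E) E |>.flip (TensorProduct.curry f).flip).flip)
  have : f = g ∘ₗ LinearMap.rTensor L (evalMap A F E) := by
    ext x m
    simp [g, evalMap]
  rw [this, LinearMap.comp_apply, hz, map_zero]

lemma aux_flat_dual [IsNoetherianRing A] {E I : Type u} [AddCommGroup E] [Module A E]
    [AddCommGroup I] [Module A I] (hE : Module.Injective A E) (hI : Module.Injective A I) :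
    Module.Flat A (I →ₗ[A] E) := by
  refine Module.Flat.of_forall_isTrivialRelation fun {l a φ} h => ?_
  let K : Submodule A (Fin l → A) := LinearMap.ker (Fintype.linearCombination A a)
  obtain ⟨n, b, hb⟩ := Submodule.fg_iff_exists_fin_generating_family.1
    (IsNoetherian.noetherian K)
  let B : (Fin l → I) →ₗ[A] (Fin n → I) :=
    LinearMap.pi fun k => ∑ i, b k i • LinearMap.proj i
  let Φ : (Fin l → I) →ₗ[A] E := ∑ i, φ i ∘ₗ LinearMap.proj i
  have key : ∀ y, B y = 0 → Φ y = 0 := by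
    intro y hy
    obtain ⟨t, ht⟩ := aux_factor hI (Fintype.linearCombination A a)
      (Fintype.linearCombination A y) (by
        intro c hc
        have hc : c ∈ K := hc
        have : K ≤ LinearMap.ker (Fintype.linearCombination A y) := by
          rw [← hb, Submodule.span_le]
          rintro _ ⟨k, rfl⟩
          have := congrFun hy k
          simpa [B, Fintype.linearCombination_apply] using this
        exact this hc)
    have hy' : ∀ i, y i = a i • t 1 := by
      intro i
      have := ht (Pi.single i 1)
      simp only [Fintype.linearCombination_apply_single, one_smul] at this
      rw [← this, ← map_smul, smul_eq_mul, mul_one]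
    have := LinearMap.congr_fun h (t 1)
    simpa [Φ, hy'] using this
  obtain ⟨ψ, hψ⟩ := aux_factor hE B Φ key
  refine ⟨n, fun i k => b k i, fun k => ψ ∘ₗ LinearMap.single A (fun _ => I) k, ?_, ?_⟩
  · intro i
    ext x
    have h1 := hψ (Pi.single i x)
    have h2 : Φ (Pi.single i x) = φ i x := by
      simp only [Φ, LinearMap.sum_apply, LinearMap.comp_apply, LinearMap.proj_apply]
      rw [Finset.sum_eq_single i] <;> simp +contextual
    have h3 : B (Pi.single i x) = ∑ k, b k i • Pi.single k x := by
      ext k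
      simp [B, Pi.single_apply, Finset.sum_apply]
    rw [← h2, ← h1, h3]
    simp
  · intro k
    have : b k ∈ K := hb ▸ Submodule.subset_span ⟨k, rfl⟩
    simpa [K, Fintype.linearCombination_apply, mul_comm] using this

lemma aux_coker {E F : Type u} [AddCommGroup E] [Module A E] [AddCommGroup F]
    [Module A F] (hE : IsInjectiveCogenerator A E)
    (hP : Module.Flat A ((F →ₗ[A] E) →ₗ[A] E)) :
    Module.Flat A (((F →ₗ[A] E) →ₗ[A] E) ⧸ LinearMap.range (evalMap A F E)) := by
  apply aux_flat_of_dual_injective hE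
  have hD := aux_dual_injective hE.1 hP
  constructor
  intro X Y _ _ _ _ f hf g
  let R := LinearMap.range (evalMap A F E)
  obtain ⟨k, hk⟩ := hD.out f hf (LinearMap.lcomp A E R.mkQ ∘ₗ g)
  -- the retraction
  let r : (((F →ₗ[A] E) →ₗ[A] E) →ₗ[A] E) →ₗ[A] (((F →ₗ[A] E) →ₗ[A] E) →ₗ[A] E) :=
    LinearMap.id - evalMap A (F →ₗ[A] E) E ∘ₗ LinearMap.lcomp A E (evalMap A F E)
  have hr : ∀ ψ, R ≤ LinearMap.ker (r ψ) := by
    rintro ψ _ ⟨x, rfl⟩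
    simp [r, evalMap]
  let s : Y →ₗ[A] ((((F →ₗ[A] E) →ₗ[A] E) ⧸ R) →ₗ[A] E) :=
    { toFun := fun y => R.liftQ (r (k y)) (hr _)
      map_add' := by
        intro x y
        apply Submodule.linearMap_qext
        ext m
        simp
      map_smul' := by
        intro x y
        apply Submodule.linearMap_qext
        ext m
        simp }
  refine ⟨s, fun x => ?_⟩
  apply Submodule.linearMap_qext
  ext m
  have h0 : LinearMap.lcomp A E (evalMap A F E) (LinearMap.lcomp A E R.mkQ (g x)) = 0 := by
    ext y
    have : R.mkQ (evalMap A F E y) = 0 := (Submodule.Quotient.mk_eq_zero _).2 ⟨y, rfl⟩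
    simp only [LinearMap.lcomp_apply, this, map_zero, LinearMap.zero_apply]
  simp only [s, LinearMap.coe_mk, AddHom.coe_mk, Submodule.liftQ_mkQ, hk, LinearMap.comp_apply, r,
    LinearMap.sub_apply, LinearMap.id_apply, h0, map_zero, LinearMap.zero_apply, sub_zero]
  simp

lemma aux_extend {E M G P₀ P₁ : Type u} [AddCommGroup E] [Module A E] [AddCommGroup M] [Module A M]
    [AddCommGroup G] [Module A G] [AddCommGroup P₀] [Module A P₀] [AddCommGroup P₁] [Module A P₁]
    (hE : Module.Injective A E) (hG : Module.Flat A G) (d : P₁ →ₗ[A] P₀) (p : P₀ →ₗ[A] G)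
    (hdp : Function.Exact d p) (hp : Function.Surjective p) (f : P₁ →ₗ[A] (M →ₗ[A] E))
    (hf : ∀ x, d x = 0 → f x = 0) : ∃ k : P₀ →ₗ[A] (M →ₗ[A] E), ∀ x, k (d x) = f x := by
  have hinj : Function.Injective (LinearMap.lTensor M (LinearMap.range d).subtype) := by
    refine LinearMap.lTensor_injective_of_exact_of_flat p hp _ Subtype.val_injective ?_ M
    intro x
    rw [hdp x]
    simp
  obtain ⟨e, he⟩ : ∃ e : LinearMap.range d →ₗ[A] (M →ₗ[A] E), ∀ x, e (d.rangeRestrict x) = f x := by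
    refine ⟨(LinearMap.ker d).liftQ f (fun x hx => LinearMap.mem_ker.2 (hf x (LinearMap.mem_ker.1 hx))) ∘ₗ
      d.quotKerEquivRange.symm.toLinearMap, fun x => ?_⟩
    have : d.quotKerEquivRange.symm (d.rangeRestrict x) = Submodule.Quotient.mk x := by
      rw [LinearEquiv.symm_apply_eq]; rfl
    rw [LinearMap.comp_apply, LinearEquiv.coe_coe, this, Submodule.liftQ_apply]
  obtain ⟨k, hk⟩ := hE.out _ hinj (TensorProduct.lift e.flip)
  refine ⟨(TensorProduct.curry k).flip, fun x => ?_⟩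
  ext m
  have := hk (m ⊗ₜ d.rangeRestrict x)
  simp only [LinearMap.lTensor_tmul, TensorProduct.lift.tmul, LinearMap.flip_apply, he] at this
  simpa using this

lemma aux_cotorsion {E M : Type u} [AddCommGroup E] [Module A E] [AddCommGroup M] [Module A M]
    (hE : Module.Injective A E) : IsCotorsion A (M →ₗ[A] E) := by
  intro G _ _ hG
  let P := ProjectiveResolution.of (ModuleCat.of A G)
  let C := ModuleCat.of A (M →ₗ[A] E)
  suffices h : Limits.IsZero (((Ext A (ModuleCat.{u} A) 1).obj
      (Opposite.op (ModuleCat.of A G))).obj C) from ModuleCat.subsingleton_of_isZero h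
  refine Limits.IsZero.of_iso ?_ (P.isoExt 1 C)
  rw [← HomologicalComplex.exactAt_iff_isZero_homology,
    HomologicalComplex.exactAt_iff' _ 0 1 2 (by simp) (by simp), ShortComplex.moduleCat_exact_iff]
  intro (f : P.complex.X 1 ⟶ C) (hf : P.complex.d 2 1 ≫ f = 0)
  have h1 := (ShortComplex.moduleCat_exact_iff _).1 (P.exact_succ 0)
  have h0 := (ShortComplex.moduleCat_exact_iff _).1 P.exact₀
  have hs : Function.Surjective (P.π.f 0).hom := (ModuleCat.epi_iff_surjective _).1 inferInstance
  obtain ⟨k, hk⟩ := aux_extend (G := G) hE hG (P.complex.d 1 0).hom (P.π.f 0).hom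
    (by
      intro x
      constructor
      · intro hx
        exact h0 x hx
      · rintro ⟨y, rfl⟩
        exact ConcreteCategory.congr_hom P.complex_d_comp_π_f_zero y) hs f.hom (by
      intro x hx
      obtain ⟨y, rfl⟩ := h1 x hx
      exact ConcreteCategory.congr_hom hf y)
  refine ⟨(ModuleCat.ofHom k : P.complex.X 0 ⟶ C), ?_⟩
  show P.complex.d 1 0 ≫ (ModuleCat.ofHom k : P.complex.X 0 ⟶ C) = f
  ext x : 2
  exact hk x

end aux

/-- For a flat module `F` over a commutative noetherian ring and an injective cogenerator `E`,
the evaluation map `α : F → Hom_A(Hom_A(F,E), E)` is a pure monomorphism into a cotorsion flat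
module with flat cokernel, giving a short exact sequence `0 → F → Hom(Hom(F,E),E) → F' → 0`. -/
theorem evalMap_pure_mono_cotorsionFlat_flat_cokernel
    (A : Type u) [CommRing A] [IsNoetherianRing A]
    (F E : Type u) [AddCommGroup F] [Module A F] [AddCommGroup E] [Module A E]
    (hF : Module.Flat A F) (hE : IsInjectiveCogenerator A E) :
    Function.Injective (evalMap A F E) ∧
    (∀ (L : Type u) [AddCommGroup L] [Module A L],
        Function.Injective (LinearMap.rTensor L (evalMap A F E))) ∧
    IsCotorsionFlat A ((F →ₗ[A] E) →ₗ[A] E) ∧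
    Module.Flat A (((F →ₗ[A] E) →ₗ[A] E) ⧸ LinearMap.range (evalMap A F E)) := by
  have hfl := aux_flat_dual hE.1 (aux_dual_injective hE.1 hF)
  refine ⟨?_, fun L _ _ => aux_pure hE L, ⟨aux_cotorsion hE.1, hfl⟩, aux_coker hE hfl⟩
  rw [injective_iff_map_eq_zero]
  intro z hz
  exact aux_sep hE z fun f => LinearMap.congr_fun hz f
end

section
/- Let A be a commutative noetherian ring, F a flat A-module, and E an injective cogenerator of the category of A-modules. The following are equivalent: (i) F is cotorsion; (ii) the canonical evaluation map α : F → Hom_A(Hom_A(F, E), E) is a split monomorphism; (iii) F is a direct summand of a module of the form Hom_A(I, I') for some injective A-modules I and I'. -/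
universe u

open CategoryTheory in
lemma ext_one_aux (A : Type u) [CommRing A] (G C : ModuleCat.{u} A)
    (P : ProjectiveResolution G) :
    Subsingleton (((Ext A (ModuleCat.{u} A) 1).obj (Opposite.op G)).obj C) ↔
      ∀ g : P.complex.X 1 ⟶ C, P.complex.d 2 1 ≫ g = 0 →
        ∃ h : P.complex.X 0 ⟶ C, P.complex.d 1 0 ≫ h = g := by
  rw [← ModuleCat.isZero_iff_subsingleton, (P.isoExt (R := A) 1 C).isZero_iff,
    ← HomologicalComplex.exactAt_iff_isZero_homology,
    HomologicalComplex.exactAt_iff' _ 0 1 2 (by simp) (by simp),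
    ShortComplex.moduleCat_exact_iff]
  exact Iff.rfl

open CategoryTheory in
lemma ext_one_res (A : Type u) [CommRing A] (G C : Type u) [AddCommGroup G] [Module A G]
    [AddCommGroup C] [Module A C] :
    ∃ (P0 : Type u) (_ : AddCommGroup P0) (_ : Module A P0)
      (P1 : Type u) (_ : AddCommGroup P1) (_ : Module A P1)
      (P2 : Type u) (_ : AddCommGroup P2) (_ : Module A P2)
      (d2 : P2 →ₗ[A] P1) (d1 : P1 →ₗ[A] P0) (π : P0 →ₗ[A] G),
      Module.Projective A P0 ∧ Function.Exact d2 d1 ∧ Function.Exact d1 π ∧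
      Function.Surjective π ∧
      (Subsingleton (((Ext A (ModuleCat.{u} A) 1).obj
        (Opposite.op (ModuleCat.of A G))).obj (ModuleCat.of A C)) ↔
        ∀ g : P1 →ₗ[A] C, g ∘ₗ d2 = 0 → ∃ h : P0 →ₗ[A] C, h ∘ₗ d1 = g) := by
  let P := projectiveResolution (ModuleCat.of A G)
  refine ⟨P.complex.X 0, inferInstance, inferInstance, P.complex.X 1, inferInstance,
    inferInstance, P.complex.X 2, inferInstance, inferInstance,
    (P.complex.d 2 1).hom, (P.complex.d 1 0).hom, (P.π.f 0).hom, ?_, ?_, ?_, ?_, ?_⟩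
  · exact (IsProjective.iff_projective (R := A) (P.complex.X 0)).mpr (P.projective 0)
  · have := P.exact_succ 0
    rw [ShortComplex.moduleCat_exact_iff_range_eq_ker] at this
    exact LinearMap.exact_iff.mpr this.symm
  · have := P.exact₀
    rw [ShortComplex.moduleCat_exact_iff_range_eq_ker] at this
    have h2 := LinearMap.exact_iff.mpr this.symm
    exact h2
  · have he : Epi (P.π.f 0) := inferInstance
    have hs := (ModuleCat.epi_iff_surjective (P.π.f 0)).mp he
    exact hs
  · rw [ext_one_aux A _ _ P]
    constructor
    · intro H g hg
      obtain ⟨h, hh⟩ := H (ModuleCat.ofHom g) (ModuleCat.hom_ext hg)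
      exact ⟨h.hom, congrArg ModuleCat.Hom.hom hh⟩
    · intro H g hg
      obtain ⟨h, hh⟩ := H g.hom (congrArg ModuleCat.Hom.hom hg)
      exact ⟨ModuleCat.ofHom h, ModuleCat.hom_ext hh⟩

/-- splitting of extensions with vanishing Ext -/
lemma split_of_ext (A : Type u) [CommRing A] (F M G : Type u) [AddCommGroup F] [Module A F]
    [AddCommGroup M] [Module A M] [AddCommGroup G] [Module A G]
    (i : F →ₗ[A] M) (p : M →ₗ[A] G) (hi : Function.Injective i) (hp : Function.Surjective p)
    (hip : Function.Exact i p)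
    (h : Subsingleton (((Ext A (ModuleCat.{u} A) 1).obj
        (Opposite.op (ModuleCat.of A G))).obj (ModuleCat.of A F))) :
    ∃ r : M →ₗ[A] F, r ∘ₗ i = LinearMap.id := by
  obtain ⟨P0, _, _, P1, _, _, P2, _, _, d2, d1, π, hP, h21, h10, hπ, H⟩ := ext_one_res A G F
  rw [H] at h
  obtain ⟨φ, hφ⟩ := Module.projective_lifting_property p π hp
  have hmem : ∀ x, φ (d1 x) ∈ LinearMap.range i := fun x => by
    refine (hip _).mp ?_
    rw [← LinearMap.comp_apply, hφ]
    exact h10.apply_apply_eq_zero x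
  let e := LinearEquiv.ofInjective i hi
  let g : P1 →ₗ[A] F := e.symm.toLinearMap ∘ₗ (φ ∘ₗ d1).codRestrict (LinearMap.range i) hmem
  have hg : ∀ x, i (g x) = φ (d1 x) := fun x => by
    have := e.apply_symm_apply ((φ ∘ₗ d1).codRestrict (LinearMap.range i) hmem x)
    exact congrArg Subtype.val this
  obtain ⟨k, hk⟩ := h g (by
    ext x
    apply hi
    simp [hg, h21.apply_apply_eq_zero])
  -- the section
  have hker : ∀ x, π x = 0 → (φ - i ∘ₗ k) x = 0 := by
    intro x hx
    obtain ⟨y, rfl⟩ := (h10 x).mp hx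
    have : k (d1 y) = g y := LinearMap.congr_fun hk y
    simp [this, hg]
  -- the retraction: m ↦ i⁻¹ (m - s (p m))
  have key : ∀ m, ∃ f : F, ∀ x, π x = p m → i f = m - (φ - i ∘ₗ k) x := by
    intro m
    obtain ⟨x, hx⟩ := hπ (p m)
    have : m - (φ - i ∘ₗ k) x ∈ Set.range i := by
      refine (hip _).mp ?_
      have h1 : p (φ x) = π x := LinearMap.congr_fun hφ x
      simp [h1, hx, hip.apply_apply_eq_zero]
    obtain ⟨f, hf⟩ := this
    refine ⟨f, fun x' hx' => ?_⟩
    have := hker (x' - x) (by simp [hx, hx'])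
    rw [map_sub, sub_eq_zero] at this
    rw [this, hf]
  choose r hr using key
  refine ⟨{ toFun := r, map_add' := ?_, map_smul' := ?_ }, ?_⟩
  · intro a b
    obtain ⟨x, hx⟩ := hπ (p a)
    obtain ⟨y, hy⟩ := hπ (p b)
    apply hi
    rw [map_add, hr a x hx, hr b y hy, hr (a + b) (x + y) (by simp [hx, hy]), map_add]
    abel
  · intro c a
    obtain ⟨x, hx⟩ := hπ (p a)
    apply hi
    rw [RingHom.id_apply, map_smul, hr a x hx, hr (c • a) (c • x) (by simp [hx]), map_smul,
      smul_sub]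
  · ext f
    apply hi
    simpa using hr (i f) 0 (by simp [hip.apply_apply_eq_zero])

open TensorProduct in
/-- extension of maps into `Hom(I, I')` -/
lemma extend_hom (A : Type u) [CommRing A] (X Y I I' : Type u) [AddCommGroup X] [Module A X]
    [AddCommGroup Y] [Module A Y] [AddCommGroup I] [Module A I] [AddCommGroup I'] [Module A I']
    (hI' : Module.Injective A I') (j : X →ₗ[A] Y) (hj : Function.Injective (j.lTensor I))
    (g : X →ₗ[A] (I →ₗ[A] I')) : ∃ h : Y →ₗ[A] (I →ₗ[A] I'), h ∘ₗ j = g := by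
  obtain ⟨h, hh⟩ := hI'.out (j.lTensor I) hj (TensorProduct.lift g.flip)
  refine ⟨(TensorProduct.curry h).flip, ?_⟩
  ext x i
  simpa using hh (i ⊗ₜ x)

lemma cotorsion_of_summand (A : Type u) [CommRing A] (F I I' : Type u)
    [AddCommGroup F] [Module A F] [AddCommGroup I] [Module A I] [AddCommGroup I'] [Module A I']
    (hI' : Module.Injective A I') (s : F →ₗ[A] (I →ₗ[A] I')) (r : (I →ₗ[A] I') →ₗ[A] F)
    (hrs : r ∘ₗ s = LinearMap.id) : IsCotorsion A F := by
  intro G _ _ hG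
  obtain ⟨P0, _, _, P1, _, _, P2, _, _, d2, d1, π, hP, h21, h10, hπ, H⟩ := ext_one_res A G F
  rw [H]
  intro g hg
  have hle : LinearMap.ker d1.rangeRestrict ≤ LinearMap.ker g := by
    intro x hx
    rw [LinearMap.ker_rangeRestrict] at hx
    obtain ⟨y, rfl⟩ := (h21 x).mp hx
    exact LinearMap.congr_fun hg y
  obtain ⟨g', hg'⟩ : ∃ g' : LinearMap.range d1 →ₗ[A] F, g' ∘ₗ d1.rangeRestrict = g := by
    refine ⟨(LinearMap.ker d1.rangeRestrict).liftQ g hle ∘ₗ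
      (d1.rangeRestrict.quotKerEquivOfSurjective d1.surjective_rangeRestrict).symm.toLinearMap, ?_⟩
    ext x
    have : (d1.rangeRestrict.quotKerEquivOfSurjective d1.surjective_rangeRestrict).symm
        (d1.rangeRestrict x) = Submodule.Quotient.mk x := by
      rw [LinearEquiv.symm_apply_eq]; rfl
    simp only [LinearMap.comp_apply, LinearEquiv.coe_coe, this]
    rfl
  have hex : Function.Exact (LinearMap.range d1).subtype π := by
    intro x
    rw [h10 x]
    simp
  obtain ⟨h, hh⟩ := extend_hom A _ _ I I' hI' (LinearMap.range d1).subtype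
    (LinearMap.lTensor_injective_of_exact_of_flat π hπ _ (Submodule.subtype_injective _) hex I)
    (s ∘ₗ g')
  refine ⟨r ∘ₗ h, ?_⟩
  ext x
  have h1 : h (d1 x) = s (g' (d1.rangeRestrict x)) := LinearMap.congr_fun hh (d1.rangeRestrict x)
  have h2 : g' (d1.rangeRestrict x) = g x := LinearMap.congr_fun hg' x
  simp only [LinearMap.comp_apply, h1, h2]
  exact LinearMap.congr_fun hrs (g x)

lemma hom_injective (A : Type u) [CommRing A] (F E : Type u) [AddCommGroup F] [Module A F]
    [AddCommGroup E] [Module A E] (hF : Module.Flat A F) (hE : Module.Injective A E) :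
    Module.Injective A (F →ₗ[A] E) := by
  constructor
  intro X Y _ _ _ _ f hf g
  obtain ⟨h, hh⟩ := extend_hom A X Y F E hE f (Module.Flat.lTensor_preserves_injective_linearMap f hf) g
  exact ⟨h, LinearMap.congr_fun hh⟩

lemma sep (A : Type u) [CommRing A] (E : Type u) [AddCommGroup E] [Module A E]
    (hE : IsInjectiveCogenerator A E) (M : Type u) [AddCommGroup M] [Module A M] (x : M)
    (hx : ∀ f : M →ₗ[A] E, f x = 0) : x = 0 := by
  have := hE.2 (A ∙ x) (fun f => by
    obtain ⟨h, hh⟩ := hE.1.out (A ∙ x).subtype (Submodule.subtype_injective _) f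
    ext ⟨y, hy⟩
    obtain ⟨a, rfl⟩ := Submodule.mem_span_singleton.mp hy
    rw [← hh]
    simp [hx])
  have h2 := Subsingleton.elim (⟨x, Submodule.mem_span_singleton_self x⟩ : A ∙ x) 0
  exact congrArg Subtype.val h2

open TensorProduct in
lemma flat_of_dual_injective (A : Type u) [CommRing A] (E : Type u) [AddCommGroup E] [Module A E]
    (hE : IsInjectiveCogenerator A E) (M : Type u) [AddCommGroup M] [Module A M]
    (hM : Module.Injective A (M →ₗ[A] E)) : Module.Flat A M := by
  rw [Module.Flat.iff_rTensor_injective']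
  intro I
  rw [injective_iff_map_eq_zero]
  intro x hx
  apply sep A E hE
  intro f
  obtain ⟨h, hh⟩ := hM.out I.subtype (Submodule.subtype_injective _) (TensorProduct.curry f)
  have : f = TensorProduct.lift h ∘ₗ LinearMap.rTensor M I.subtype := by
    ext a m
    simpa using (LinearMap.congr_fun (hh a) m).symm
  rw [this, LinearMap.comp_apply, hx, map_zero]

lemma injective_of_retract (A : Type u) [CommRing A] (M N : Type u) [AddCommGroup M] [Module A M]
    [AddCommGroup N] [Module A N] (hN : Module.Injective A N) (s : M →ₗ[A] N) (r : N →ₗ[A] M)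
    (h : ∀ x, r (s x) = x) : Module.Injective A M := by
  constructor
  intro X Y _ _ _ _ f hf g
  obtain ⟨k, hk⟩ := hN.out f hf (s ∘ₗ g)
  exact ⟨r ∘ₗ k, fun x => by simp [hk, h]⟩

lemma flat_hom (A : Type u) [CommRing A] [IsNoetherianRing A] (I E : Type u)
    [AddCommGroup I] [Module A I] [AddCommGroup E] [Module A E]
    (hI : Module.Injective A I) (hE : Module.Injective A E) : Module.Flat A (I →ₗ[A] E) := by
  apply Module.Flat.of_forall_isTrivialRelation
  intro l f x hfx
  -- syzygies
  let φ : (Fin l → A) →ₗ[A] A := Fintype.linearCombination A f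
  have hφ : ∀ v, φ v = ∑ i, v i * f i := fun v => by
    simp [φ, Fintype.linearCombination_apply]
  obtain ⟨k, b, hb⟩ := Submodule.fg_iff_exists_fin_generating_family.mp
    (IsNoetherian.noetherian (LinearMap.ker φ))
  let T : (Fin l → I) →ₗ[A] (Fin k → I) := LinearMap.pi fun j => ∑ i, b j i • LinearMap.proj i
  have hT : ∀ u j, T u j = ∑ i, b j i • u i := fun u j => by simp [T]
  let X : (Fin l → I) →ₗ[A] E := ∑ i, x i ∘ₗ LinearMap.proj i
  have hX : ∀ u, X u = ∑ i, x i (u i) := fun u => by simp [X]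
  have hker : LinearMap.ker T.rangeRestrict ≤ LinearMap.ker X := by
    intro u hu
    rw [LinearMap.ker_rangeRestrict, LinearMap.mem_ker] at hu
    let U : (Fin l → A) →ₗ[A] I := Fintype.linearCombination A u
    have hU : ∀ v, U v = ∑ i, v i • u i := fun v => by
      simp [U, Fintype.linearCombination_apply]
    have hle : LinearMap.ker φ ≤ LinearMap.ker U := by
      rw [← hb, Submodule.span_le]
      rintro _ ⟨j, rfl⟩
      have := congrFun hu j
      rw [hT] at this
      simpa [hU] using this
    obtain ⟨w, hw⟩ := hI.out ((LinearMap.ker φ).liftQ φ le_rfl)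
      (LinearMap.ker_eq_bot.mp (Submodule.ker_liftQ_eq_bot' _ _ rfl))
      ((LinearMap.ker φ).liftQ U hle)
    have hui : ∀ i, u i = f i • w 1 := by
      intro i
      have h1 := hw (Submodule.Quotient.mk (Pi.single i 1))
      simp only [Submodule.liftQ_apply] at h1
      rw [hφ, hU] at h1
      simp only [Pi.single_apply, ite_mul, one_mul, zero_mul, ite_smul, one_smul, zero_smul,
        Finset.sum_ite_eq', Finset.mem_univ, if_true] at h1
      rw [← h1, ← map_smul, smul_eq_mul, mul_one]
    rw [LinearMap.mem_ker, hX]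
    have := LinearMap.congr_fun hfx (w 1)
    simpa [hui] using this
  obtain ⟨Y, hY⟩ := hE.out ((LinearMap.ker T).liftQ T le_rfl)
      (LinearMap.ker_eq_bot.mp (Submodule.ker_liftQ_eq_bot' _ _ rfl))
      ((LinearMap.ker T).liftQ X (by rwa [LinearMap.ker_rangeRestrict] at hker))
  have hYT : ∀ u, Y (T u) = X u := fun u => hY (Submodule.Quotient.mk u)
  refine ⟨k, fun i j => b j i, fun j => Y ∘ₗ LinearMap.single A (fun _ => I) j, ?_, ?_⟩
  · intro i
    ext v
    have h1 := hYT (Pi.single i v)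
    have h2 : X (Pi.single i v) = x i v := by
      rw [hX, Finset.sum_eq_single i] <;> simp +contextual [Pi.single_apply]
    have h3 : T (Pi.single i v) = ∑ j, b j i • Pi.single j v := by
      ext j
      rw [hT, Finset.sum_eq_single i, Finset.sum_apply, Finset.sum_eq_single j] <;>
        simp +contextual [Pi.single_apply, eq_comm]
    rw [h2, h3] at h1
    rw [← h1]
    simp
  · intro j
    have : b j ∈ LinearMap.ker φ := hb ▸ Submodule.subset_span ⟨j, rfl⟩
    rw [LinearMap.mem_ker, hφ] at this
    simpa [mul_comm] using this

lemma split_eval (A : Type u) [CommRing A] [IsNoetherianRing A]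
    (F E : Type u) [AddCommGroup F] [Module A F] [AddCommGroup E] [Module A E]
    (hF : Module.Flat A F) (hE : IsInjectiveCogenerator A E) (hc : IsCotorsion A F) :
    ∃ r : ((F →ₗ[A] E) →ₗ[A] E) →ₗ[A] F, r ∘ₗ evalMap A F E = LinearMap.id := by
  have hev : ∀ (x : F) (g : F →ₗ[A] E), evalMap A F E x g = g x := fun _ _ => rfl
  have hflat : Module.Flat A ((F →ₗ[A] E) →ₗ[A] E) :=
    flat_hom A _ E (hom_injective A F E hF hE.1) hE.1
  have hinj : Function.Injective (evalMap A F E) := by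
    rw [injective_iff_map_eq_zero]
    intro x hx
    exact sep A E hE F x fun f => LinearMap.congr_fun hx f
  let R := LinearMap.range (evalMap A F E)
  refine split_of_ext A F _ (_ ⧸ R) (evalMap A F E) R.mkQ hinj R.mkQ_surjective
    (LinearMap.exact_map_mkQ_range _) (hc _ ?_)
  apply flat_of_dual_injective A E hE
  -- dual of the cokernel is a retract of the triple dual
  let s : ((((F →ₗ[A] E) →ₗ[A] E) ⧸ R) →ₗ[A] E) →ₗ[A] (((F →ₗ[A] E) →ₗ[A] E) →ₗ[A] E) :=
    LinearMap.lcomp A E R.mkQ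
  let t : (((F →ₗ[A] E) →ₗ[A] E) →ₗ[A] E) →ₗ[A] (((F →ₗ[A] E) →ₗ[A] E) →ₗ[A] E) :=
    LinearMap.id - evalMap A (F →ₗ[A] E) E ∘ₗ LinearMap.lcomp A E (evalMap A F E)
  have ht : ∀ ψ, R ≤ LinearMap.ker (t ψ) := by
    rintro ψ _ ⟨x, rfl⟩
    rw [LinearMap.mem_ker]
    change ψ (evalMap A F E x) - ψ (evalMap A F E x) = 0
    exact sub_self _
  refine injective_of_retract A _ _ (hom_injective A _ E hflat hE.1) s
    { toFun := fun ψ => R.liftQ (t ψ) (ht ψ), map_add' := ?_, map_smul' := ?_ } ?_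
  · intro a b
    apply Submodule.linearMap_qext
    ext y
    simp
  · intro a b
    apply Submodule.linearMap_qext
    ext y
    simp
  · intro c
    apply Submodule.linearMap_qext
    ext y
    change c (R.mkQ y) - y (c ∘ₗ R.mkQ ∘ₗ evalMap A F E) = c (R.mkQ y)
    have : R.mkQ ∘ₗ evalMap A F E = 0 := LinearMap.range_mkQ_comp _
    rw [this]
    simp

/-- For a flat module `F` over a commutative noetherian ring and an injective cogenerator `E`,
the following are equivalent: (i) `F` is cotorsion; (ii) the evaluation map
`α : F → Hom_A(Hom_A(F,E),E)` is a split monomorphism; (iii) `F` is a direct summand of some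
`Hom_A(I, I')` with `I`, `I'` injective. -/
theorem cotorsion_tfae (A : Type u) [CommRing A] [IsNoetherianRing A]
    (F E : Type u) [AddCommGroup F] [Module A F] [AddCommGroup E] [Module A E]
    (hF : Module.Flat A F) (hE : IsInjectiveCogenerator A E) :
    (IsCotorsion A F ↔
      ∃ r : ((F →ₗ[A] E) →ₗ[A] E) →ₗ[A] F, r ∘ₗ evalMap A F E = LinearMap.id) ∧
    (IsCotorsion A F ↔
      ∃ (I : Type u) (_ : AddCommGroup I) (_ : Module A I)
        (I' : Type u) (_ : AddCommGroup I') (_ : Module A I'),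
        Module.Injective A I ∧ Module.Injective A I' ∧
        ∃ (s : F →ₗ[A] (I →ₗ[A] I')) (r : (I →ₗ[A] I') →ₗ[A] F),
          r ∘ₗ s = LinearMap.id) := by
  have h12 := split_eval A F E hF hE
  have h23 : (∃ r : ((F →ₗ[A] E) →ₗ[A] E) →ₗ[A] F, r ∘ₗ evalMap A F E = LinearMap.id) →
      ∃ (I : Type u) (_ : AddCommGroup I) (_ : Module A I)
        (I' : Type u) (_ : AddCommGroup I') (_ : Module A I'),
        Module.Injective A I ∧ Module.Injective A I' ∧
        ∃ (s : F →ₗ[A] (I →ₗ[A] I')) (r : (I →ₗ[A] I') →ₗ[A] F),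
          r ∘ₗ s = LinearMap.id := fun ⟨r, hr⟩ =>
    ⟨F →ₗ[A] E, inferInstance, inferInstance, E, inferInstance, inferInstance,
      hom_injective A F E hF hE.1, hE.1, evalMap A F E, r, hr⟩
  have h31 : (∃ (I : Type u) (_ : AddCommGroup I) (_ : Module A I)
        (I' : Type u) (_ : AddCommGroup I') (_ : Module A I'),
        Module.Injective A I ∧ Module.Injective A I' ∧
        ∃ (s : F →ₗ[A] (I →ₗ[A] I')) (r : (I →ₗ[A] I') →ₗ[A] F),
          r ∘ₗ s = LinearMap.id) → IsCotorsion A F := by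
    rintro ⟨I, _, _, I', _, _, -, hI', s, r, hrs⟩
    exact cotorsion_of_summand A F I I' hI' s r hrs
  exact ⟨⟨h12, fun h => h31 (h23 h)⟩, ⟨fun h => h23 (h12 h), h31⟩⟩
end

section
/- Let A be a commutative noetherian ring and F a cochain complex of flat A-modules. Then F is N-totally acyclic if and only if for every prime ideal p of A the localized complex F_p = F ⊗_A A_p is an N-totally acyclic complex of flat A_p-modules. -/
universe u

/-- A cochain complex `(X, d)` of flat `A`-modules is *N-totally acyclic* if it is acyclic
and `X ⊗_A I` is acyclic for every injective `A`-module `I`. -/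
def IsNTotallyAcyclic (A : Type u) [CommRing A] (X : ℤ → Type u)
    [∀ n, AddCommGroup (X n)] [∀ n, Module A (X n)]
    (d : ∀ n, X n →ₗ[A] X (n + 1)) : Prop :=
  (∀ n, Function.Exact (d n) (d (n + 1))) ∧
  ∀ (I : Type u) [AddCommGroup I] [Module A I], Module.Injective A I →
    ∀ n, Function.Exact (LinearMap.rTensor I (d n)) (LinearMap.rTensor I (d (n + 1)))

/-- The localization of a linear map at a submonoid `p`, as a `Localization p`-linear map. -/
noncomputable def locMap (A : Type u) [CommRing A] (p : Submonoid A)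
    {M N : Type u} [AddCommGroup M] [Module A M] [AddCommGroup N] [Module A N]
    (f : M →ₗ[A] N) :
    LocalizedModule p M →ₗ[Localization p] LocalizedModule p N :=
  LinearMap.extendScalarsOfIsLocalization p (Localization p)
    (IsLocalizedModule.map p (LocalizedModule.mkLinearMap p M)
      (LocalizedModule.mkLinearMap p N) f)

open TensorProduct in
lemma exact_rTensor_loc_iff (A : Type u) [CommRing A] (p : Submonoid A)
    {M N P J : Type u} [AddCommGroup M] [Module A M] [AddCommGroup N] [Module A N]
    [AddCommGroup P] [Module A P] [AddCommGroup J] [Module A J] [Module (Localization p) J]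
    [IsScalarTower A (Localization p) J]
    (f : M →ₗ[A] N) (g : N →ₗ[A] P) :
    Function.Exact (LinearMap.rTensor J (locMap A p f)) (LinearMap.rTensor J (locMap A p g)) ↔
    Function.Exact
      (LinearMap.rTensor J (IsLocalizedModule.map p (LocalizedModule.mkLinearMap p M)
        (LocalizedModule.mkLinearMap p N) f))
      (LinearMap.rTensor J (IsLocalizedModule.map p (LocalizedModule.mkLinearMap p N)
        (LocalizedModule.mkLinearMap p P) g)) := by
  symm
  refine Function.Exact.iff_of_ladder_addEquiv
    (IsLocalization.moduleTensorEquiv p (Localization p) (LocalizedModule p M) J).toAddEquiv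
    (IsLocalization.moduleTensorEquiv p (Localization p) (LocalizedModule p N) J).toAddEquiv
    (IsLocalization.moduleTensorEquiv p (Localization p) (LocalizedModule p P) J).toAddEquiv
    (f₁₂ := (LinearMap.rTensor J (locMap A p f)).toAddMonoidHom)
    (f₂₃ := (LinearMap.rTensor J (locMap A p g)).toAddMonoidHom)
    (g₁₂ := (LinearMap.rTensor J (IsLocalizedModule.map p (LocalizedModule.mkLinearMap p M)
        (LocalizedModule.mkLinearMap p N) f)).toAddMonoidHom)
    (g₂₃ := (LinearMap.rTensor J (IsLocalizedModule.map p (LocalizedModule.mkLinearMap p N)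
        (LocalizedModule.mkLinearMap p P) g)).toAddMonoidHom) ?_ ?_
  all_goals
    ext x
    induction x using TensorProduct.induction_on with
    | zero => simp
    | add x y hx hy => rw [map_add, map_add, hx, hy]
    | tmul x y => rfl

lemma injective_restrict (A : Type u) [CommRing A] (p : Submonoid A)
    {J : Type u} [AddCommGroup J] [Module A J] [Module (Localization p) J]
    [IsScalarTower A (Localization p) J] (hJ : Module.Injective (Localization p) J) :
    Module.Injective A J := by
  refine ⟨fun P Q _ _ _ _ f hf g => ?_⟩
  have hb := IsLocalizedModule.isBaseChange p (Localization p) (LocalizedModule.mkLinearMap p P)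
  obtain ⟨h, hh⟩ := hJ.out (locMap A p f)
    (IsLocalizedModule.map_injective p (LocalizedModule.mkLinearMap p P)
      (LocalizedModule.mkLinearMap p Q) f hf) (hb.lift g)
  refine ⟨h.restrictScalars A ∘ₗ LocalizedModule.mkLinearMap p Q, fun x => ?_⟩
  have := hh (LocalizedModule.mkLinearMap p P x)
  rw [hb.lift_eq] at this
  rw [← this]
  simp [locMap, -LocalizedModule.mkLinearMap_apply]

open TensorProduct in
lemma exact_of_exact_rTensor (A : Type u) [CommRing A] (p : Submonoid A)
    {M N P J : Type u} [AddCommGroup M] [Module A M] [AddCommGroup N] [Module A N]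
    [AddCommGroup P] [Module A P] [AddCommGroup J] [Module A J]
    (f : M →ₗ[A] N) (g : N →ₗ[A] P)
    (H : Function.Exact (LinearMap.rTensor J f) (LinearMap.rTensor J g)) :
    Function.Exact
      (LinearMap.rTensor J (IsLocalizedModule.map p (LocalizedModule.mkLinearMap p M)
        (LocalizedModule.mkLinearMap p N) f))
      (LinearMap.rTensor J (IsLocalizedModule.map p (LocalizedModule.mkLinearMap p N)
        (LocalizedModule.mkLinearMap p P) g)) := by
  have key : ∀ {M N : Type u} [AddCommGroup M] [Module A M] [AddCommGroup N] [Module A N]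
      (f : M →ₗ[A] N),
      IsLocalizedModule.map p (AlgebraTensorModule.rTensor A J (LocalizedModule.mkLinearMap p M))
        (AlgebraTensorModule.rTensor A J (LocalizedModule.mkLinearMap p N)) (LinearMap.rTensor J f)
      = LinearMap.rTensor J (IsLocalizedModule.map p (LocalizedModule.mkLinearMap p M)
        (LocalizedModule.mkLinearMap p N) f) := by
    intro M N _ _ _ _ f
    apply IsLocalizedModule.linearMap_ext p
      (AlgebraTensorModule.rTensor A J (LocalizedModule.mkLinearMap p M))
      (AlgebraTensorModule.rTensor A J (LocalizedModule.mkLinearMap p N))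
    rw [IsLocalizedModule.map_comp]
    ext
    simp [-LocalizedModule.mkLinearMap_apply]
  have := IsLocalizedModule.map_exact p
    (AlgebraTensorModule.rTensor A J (LocalizedModule.mkLinearMap p M))
    (AlgebraTensorModule.rTensor A J (LocalizedModule.mkLinearMap p N))
    (AlgebraTensorModule.rTensor A J (LocalizedModule.mkLinearMap p P)) _ _ H
  rwa [key, key] at this

open TensorProduct in
lemma map_rTensor_loc (A : Type u) [CommRing A] (p : Submonoid A)
    {M N J : Type u} [AddCommGroup M] [Module A M] [AddCommGroup N] [Module A N]
    [AddCommGroup J] [Module A J] (f : M →ₗ[A] N) :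
    IsLocalizedModule.map p
      (TensorProduct.map (LocalizedModule.mkLinearMap p M) (LocalizedModule.mkLinearMap p J))
      (TensorProduct.map (LocalizedModule.mkLinearMap p N) (LocalizedModule.mkLinearMap p J))
      (LinearMap.rTensor J f)
    = LinearMap.rTensor (LocalizedModule p J)
      (IsLocalizedModule.map p (LocalizedModule.mkLinearMap p M)
        (LocalizedModule.mkLinearMap p N) f) := by
  apply IsLocalizedModule.linearMap_ext p
    (TensorProduct.map (LocalizedModule.mkLinearMap p M) (LocalizedModule.mkLinearMap p J))
    (TensorProduct.map (LocalizedModule.mkLinearMap p N) (LocalizedModule.mkLinearMap p J))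
  rw [IsLocalizedModule.map_comp]
  ext
  simp [-LocalizedModule.mkLinearMap_apply]

/-- A complex of flat modules over a commutative noetherian ring `A` is N-totally acyclic iff,
for every prime `p`, the localized complex `F_p = F ⊗_A A_p` is an N-totally acyclic complex of
flat `A_p`-modules. -/
theorem nTotallyAcyclic_iff_localizations
    (A : Type u) [CommRing A] [IsNoetherianRing A]
    (X : ℤ → Type u) [∀ n, AddCommGroup (X n)] [∀ n, Module A (X n)]
    (d : ∀ n, X n →ₗ[A] X (n + 1)) (hflat : ∀ n, Module.Flat A (X n)) :
    IsNTotallyAcyclic A X d ↔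
      ∀ (p : Ideal A) (_ : p.IsPrime),
        IsNTotallyAcyclic (Localization.AtPrime p)
          (fun n => LocalizedModule p.primeCompl (X n))
          (fun n => locMap A p.primeCompl (d n)) := by
  constructor
  · rintro ⟨h1, h2⟩ p hp
    refine ⟨fun n => ?_, fun J _ _ hJ n => ?_⟩
    · exact IsLocalizedModule.map_exact p.primeCompl (LocalizedModule.mkLinearMap _ _)
        (LocalizedModule.mkLinearMap _ _) (LocalizedModule.mkLinearMap _ _) _ _ (h1 n)
    · letI : Module A J := Module.compHom J (algebraMap A (Localization.AtPrime p))
      haveI : IsScalarTower A (Localization p.primeCompl) J :=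
        IsScalarTower.of_algebraMap_smul fun _ _ => rfl
      exact (exact_rTensor_loc_iff A p.primeCompl (d n) (d (n + 1))).2
        (exact_of_exact_rTensor A p.primeCompl _ _
          (h2 J (injective_restrict A p.primeCompl hJ) n))
  · intro H
    refine ⟨fun n => ?_, fun I _ _ hI n => ?_⟩
    · exact exact_of_isLocalized_maximal _ (fun _ _ ↦ LocalizedModule.mkLinearMap _ _)
        _ (fun _ _ ↦ LocalizedModule.mkLinearMap _ _)
        _ (fun _ _ ↦ LocalizedModule.mkLinearMap _ _) _ _
        (fun p hp => (H p hp.isPrime).1 n)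
    · refine exact_of_isLocalized_maximal _
        (fun p _ ↦ TensorProduct.map (LocalizedModule.mkLinearMap p.primeCompl _)
          (LocalizedModule.mkLinearMap p.primeCompl I))
        _ (fun p _ ↦ TensorProduct.map (LocalizedModule.mkLinearMap p.primeCompl _)
          (LocalizedModule.mkLinearMap p.primeCompl I))
        _ (fun p _ ↦ TensorProduct.map (LocalizedModule.mkLinearMap p.primeCompl _)
          (LocalizedModule.mkLinearMap p.primeCompl I)) _ _ (fun p hp => ?_)
      rw [map_rTensor_loc, map_rTensor_loc]
      have hinj : Module.Injective (Localization p.primeCompl) (LocalizedModule p.primeCompl I) :=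
        Module.injective_of_isLocalizedModule p.primeCompl
          (LocalizedModule.mkLinearMap p.primeCompl I)
      exact (exact_rTensor_loc_iff A p.primeCompl (d n) (d (n + 1))).1
        ((H p hp.isPrime).2 _ hinj n)
end

section
/- Let A be a commutative noetherian ring and S ⊆ A a multiplicatively closed set. If F is an N-totally acyclic cochain complex of flat S⁻¹A-modules, then F, regarded via restriction of scalars as a complex of flat A-modules, is N-totally acyclic over A. -/
universe u

theorem baseChange_localization_injective
    (A : Type u) [CommRing A] [IsNoetherianRing A] (S : Submonoid A)
    (I : Type u) [AddCommGroup I] [Module A I] (hI : Module.Injective A I) :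
    Module.Injective (Localization S) (TensorProduct A (Localization S) I) := by
  apply Module.Baer.injective
  intro J g
  have hB : Module.Baer A I := Module.Baer.of_injective hI
  let J0 : Ideal A := J.comap (algebraMap A (Localization S))
  let ι : J0 →ₗ[A] J :=
    { toFun := fun a => ⟨algebraMap A (Localization S) a.1, a.2⟩
      map_add' := fun a b => by ext; simp
      map_smul' := fun a b => by ext; simp [Algebra.smul_def] }
  let f : I →ₗ[A] TensorProduct A (Localization S) I :=
    TensorProduct.mk A (Localization S) I 1
  have : IsLocalizedModule S f :=
    (isLocalizedModule_iff_isBaseChange S (Localization S) f).2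
      (TensorProduct.isBaseChange A I (Localization S))
  have : Module.FinitePresentation A J0 := Module.finitePresentation_of_finite A J0
  obtain ⟨g0, s, hs⟩ := Module.FinitePresentation.exists_lift_of_isLocalizedModule S f
    ((g.restrictScalars A).comp ι)
  obtain ⟨e, he⟩ := hB J0 g0
  let c : Localization S := IsLocalization.mk' (Localization S) 1 s
  have hc : c * algebraMap A (Localization S) s = 1 := by
    rw [IsLocalization.mk'_spec, map_one]
  refine ⟨LinearMap.toSpanSingleton _ _ (c • f (e 1)), ?_⟩
  intro x hx
  obtain ⟨⟨a, t⟩, hat⟩ := IsLocalization.surj S x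
  simp only at hat
  have ha : a ∈ J0 := by
    change algebraMap A (Localization S) a ∈ J
    rw [← hat]; exact J.mul_mem_right _ hx
  have h1 : f (e a) = (s : A) • g (ι ⟨a, ha⟩) := by
    have := LinearMap.congr_fun hs ⟨a, ha⟩
    rw [he a ha]
    exact this
  have h2 : ι ⟨a, ha⟩ = algebraMap A (Localization S) t • (⟨x, hx⟩ : J) := by
    ext; change algebraMap A (Localization S) a = _ * x; rw [← hat, mul_comm]
  have h3 : f (e a) = algebraMap A (Localization S) a • f (e 1) := by
    rw [algebraMap_smul, ← map_smul, ← map_smul, smul_eq_mul, mul_one]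
  have hu : IsUnit (algebraMap A (Localization S) t) := IsLocalization.map_units _ t
  rw [h2, map_smul, h3, ← algebraMap_smul (Localization S) (s : A)] at h1
  apply hu.smul_left_cancel.1
  rw [LinearMap.toSpanSingleton_apply, smul_smul, smul_smul]
  have : algebraMap A (Localization S) t * x * c = c * algebraMap A (Localization S) a := by
    rw [← hat]; ring
  rw [smul_smul] at *
  rw [this, ← smul_smul, h1, smul_smul, ← mul_assoc, hc, one_mul]

/-- Descent of N-total acyclicity along a localization `A → S⁻¹A` of a commutative noetherian
ring: an N-totally acyclic complex of flat `S⁻¹A`-modules is, by restriction of scalars, an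
N-totally acyclic complex of flat `A`-modules. -/
theorem nTotallyAcyclic_descent_localization
    (A : Type u) [CommRing A] [IsNoetherianRing A] (S : Submonoid A)
    (X : ℤ → Type u) [∀ n, AddCommGroup (X n)]
    [∀ n, Module (Localization S) (X n)] [∀ n, Module A (X n)]
    [∀ n, IsScalarTower A (Localization S) (X n)]
    (d : ∀ n, X n →ₗ[Localization S] X (n + 1))
    (hflat : ∀ n, Module.Flat (Localization S) (X n))
    (h : IsNTotallyAcyclic (Localization S) X d) :
    IsNTotallyAcyclic A X (fun n => (d n).restrictScalars A) := by
  refine ⟨fun n => h.1 n, ?_⟩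
  intro I _ _ hI n
  have key := h.2 (TensorProduct A (Localization S) I)
    (baseChange_localization_injective A S I hI) n
  let e : ∀ m, TensorProduct (Localization S) (X m) (TensorProduct A (Localization S) I)
      ≃ₗ[Localization S] TensorProduct A (X m) I := fun m =>
    TensorProduct.AlgebraTensorModule.cancelBaseChange A (Localization S) (Localization S) (X m) I
  have nat : ∀ m y, LinearMap.rTensor I ((d m).restrictScalars A) (e m y)
      = e (m + 1) (LinearMap.rTensor (TensorProduct A (Localization S) I) (d m) y) := by
    intro m y
    induction y with
    | zero => simp
    | add a b ha hb => simp only [map_add, ha, hb]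
    | tmul x z =>
      induction z with
      | zero => simp
      | add a b ha hb => simp only [TensorProduct.tmul_add, map_add, ha, hb]
      | tmul l i => simp [e]
  intro y
  obtain ⟨y, rfl⟩ := (e (n + 1)).surjective y
  rw [nat, LinearEquiv.map_eq_zero_iff, key y]
  constructor
  · rintro ⟨z, rfl⟩
    exact ⟨e n z, nat n z⟩
  · rintro ⟨z, hz⟩
    obtain ⟨z, rfl⟩ := (e n).surjective z
    exact ⟨z, (e (n + 1)).injective (by rw [← nat, hz])⟩
end

section
/- Let A be a commutative noetherian ring and F a cochain complex of flat A-modules. Then F is acyclic with F ⊗_A I acyclic for every injective A-module I if and only if F is acyclic with Hom_A(F, C) acyclic for every cotorsion flat A-module C. -/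
universe u

section
open CategoryTheory

lemma char_factor {A : Type u} [CommRing A] {M N : Type u} [AddCommGroup M] [Module A M]
    [AddCommGroup N] [Module A N] (g : M →ₗ[A] N) (c : CharacterModule M)
    (h : ∀ x, g x = 0 → c x = 0) : ∃ c' : CharacterModule N, ∀ x, c' (g x) = c x := by
  let c1 : CharacterModule (M ⧸ LinearMap.ker g) :=
    QuotientAddGroup.lift (LinearMap.ker g).toAddSubgroup (c : M →+ AddCircle (1:ℚ))
      (fun x hx => h x hx)
  obtain ⟨c', hc'⟩ := CharacterModule.dual_surjective_of_injective
    ((LinearMap.ker g).liftQ g le_rfl)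
    (LinearMap.ker_eq_bot.1 (Submodule.ker_liftQ_eq_bot _ _ _ le_rfl)) c1
  refine ⟨c', fun x => ?_⟩
  have := DFunLike.congr_fun hc' (Submodule.Quotient.mk x)
  exact this

lemma inj_factor {A : Type u} [CommRing A] {M N I : Type u} [AddCommGroup M] [Module A M]
    [AddCommGroup N] [Module A N] [AddCommGroup I] [Module A I] (hI : Module.Injective A I)
    (g : M →ₗ[A] N) (c : M →ₗ[A] I)
    (h : ∀ x, g x = 0 → c x = 0) : ∃ c' : N →ₗ[A] I, ∀ x, c' (g x) = c x := by
  obtain ⟨c', hc'⟩ := hI.out ((LinearMap.ker g).liftQ g le_rfl)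
    (LinearMap.ker_eq_bot.1 (Submodule.ker_liftQ_eq_bot _ _ _ le_rfl))
    ((LinearMap.ker g).liftQ c (fun x hx => h x hx))
  exact ⟨c', fun x => hc' (Submodule.Quotient.mk x)⟩

lemma exact_dual_iff {A : Type u} [CommRing A] {M N P : Type u} [AddCommGroup M] [Module A M]
    [AddCommGroup N] [Module A N] [AddCommGroup P] [Module A P] (f : M →ₗ[A] N) (g : N →ₗ[A] P) :
    Function.Exact (CharacterModule.dual g) (CharacterModule.dual f) ↔ Function.Exact f g := by
  constructor
  · intro h y
    constructor
    · intro hy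
      by_contra hn
      have hne : (Submodule.Quotient.mk y : N ⧸ LinearMap.range f) ≠ 0 := by
        rw [Ne, Submodule.Quotient.mk_eq_zero]; exact hn
      obtain ⟨c, hc⟩ := CharacterModule.exists_character_apply_ne_zero_of_ne_zero hne
      obtain ⟨c', hc'⟩ := (h (CharacterModule.dual (LinearMap.range f).mkQ c)).1 (by
        ext x
        have : (Submodule.Quotient.mk (f x) : N ⧸ LinearMap.range f) = 0 := by
          rw [Submodule.Quotient.mk_eq_zero]; exact ⟨x, rfl⟩
        exact (congrArg c this).trans (map_zero c))
      apply hc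
      have := DFunLike.congr_fun hc' y
      refine Eq.trans this.symm ?_
      change c' (g y) = 0
      rw [hy, map_zero]
    · rintro ⟨x, rfl⟩
      refine CharacterModule.eq_zero_of_character_apply fun c => ?_
      have := (h (CharacterModule.dual g c)).2 ⟨c, rfl⟩
      exact DFunLike.congr_fun this x
  · intro h c
    constructor
    · intro hc
      obtain ⟨c', hc'⟩ := char_factor g c (fun x hx => by
        obtain ⟨y, rfl⟩ := (h x).1 hx
        exact DFunLike.congr_fun hc y)
      exact ⟨c', CharacterModule.ext _ fun x => hc' x⟩
    · rintro ⟨c', rfl⟩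
      ext x
      change c' (g (f x)) = 0
      rw [(h (f x)).2 ⟨x, rfl⟩, map_zero]

lemma exact_lcomp_char_iff {A : Type u} [CommRing A] {M N P I : Type u}
    [AddCommGroup M] [Module A M] [AddCommGroup I] [Module A I]
    [AddCommGroup N] [Module A N] [AddCommGroup P] [Module A P] {f : M →ₗ[A] N} {g : N →ₗ[A] P} :
    Function.Exact (LinearMap.lcomp A (CharacterModule I) g)
      (LinearMap.lcomp A (CharacterModule I) f) ↔
    Function.Exact (LinearMap.rTensor I f) (LinearMap.rTensor I g) := by
  rw [← exact_dual_iff (f.rTensor I), ← CharacterModule.dual_rTensor_conj_homEquiv, ← CharacterModule.dual_rTensor_conj_homEquiv]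
  refine (Function.Exact.iff_of_ladder_linearEquiv (e₁ := CharacterModule.homEquiv (R := A) (A := P) (B := I))
    (e₂ := CharacterModule.homEquiv (R := A) (A := N) (B := I))
    (e₃ := CharacterModule.homEquiv (R := A) (A := M) (B := I)) ?_ ?_).symm <;>
  · ext x
    simp

lemma flat_char {A : Type u} [CommRing A] [IsNoetherianRing A] {I : Type u}
    [AddCommGroup I] [Module A I] (hI : Module.Injective A I) :
    Module.Flat A (CharacterModule I) := by
  refine Module.Flat.of_forall_isTrivialRelation fun {l f x} hx => ?_
  let φ : (Fin l → A) →ₗ[A] A := Fintype.linearCombination A f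
  obtain ⟨k, s, hs⟩ := Submodule.fg_iff_exists_fin_generating_family.1
    (IsNoetherian.noetherian (LinearMap.ker φ))
  have hs' : ∀ j, ∑ i, f i * s j i = 0 := fun j => by
    have : s j ∈ LinearMap.ker φ := hs ▸ Submodule.subset_span ⟨j, rfl⟩
    simpa [φ, Fintype.linearCombination_apply, mul_comm] using this
  let T : (Fin l → I) →ₗ[A] (Fin k → I) :=
    LinearMap.pi fun j => ∑ i, s j i • LinearMap.proj i
  let c : CharacterModule (Fin l → I) :=
    ∑ i, CharacterModule.dual (LinearMap.proj (R := A) (φ := fun _ : Fin l => I) i) (x i)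
  have evl : ∀ {M : Type u} [AddCommGroup M] {n : ℕ} (q : Fin n → CharacterModule M) (z : M),
      (∑ i, q i) z = ∑ i, q i z := fun q z => by
    exact map_sum (AddMonoidHom.eval z) q _
  have hc : ∀ z, c z = ∑ i, x i (z i) := fun z => evl _ _
  obtain ⟨c', hc'⟩ := char_factor T c (fun z hz => by
    obtain ⟨χ, hχ⟩ := inj_factor hI φ (Fintype.linearCombination A z) (by
      intro b hb
      have hb : b ∈ Submodule.span A (Set.range s) := hs ▸ hb
      suffices Submodule.span A (Set.range s) ≤
        LinearMap.ker (Fintype.linearCombination A z) from this hb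
      rw [Submodule.span_le]
      rintro _ ⟨j, rfl⟩
      have := congrFun hz j
      simpa [T, Fintype.linearCombination_apply] using this)
    have hz' : ∀ i, z i = f i • χ 1 := fun i => by
      have := hχ (Pi.single i 1)
      simp [φ] at this
      rw [← this, ← map_smul]; simp
    rw [hc]
    have := DFunLike.congr_fun hx (χ 1)
    rw [evl] at this
    simp_rw [hz']
    exact this)
  refine ⟨k, fun i j => s j i, fun j => CharacterModule.dual
    (LinearMap.single A (fun _ : Fin k => I) j) c', fun i => ?_, hs'⟩
  ext w
  have h1 := hc' (Pi.single i w)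
  rw [hc] at h1
  rw [evl]
  have h2 : ∑ i', x i' ((Pi.single i w : Fin l → I) i') = x i w := by
    rw [Finset.sum_eq_single i]
    · simp
    · intro b _ hb; rw [Pi.single_eq_of_ne hb, map_zero]
    · simp
  rw [← h2, ← h1]
  have h3 : T (Pi.single i w) = ∑ j, Pi.single j (s j i • w) := by
    ext j
    simp [T, Pi.single_apply, Finset.sum_apply]
  rw [h3, map_sum]
  rfl

lemma ext1_iff {A : Type u} [CommRing A] (M C : ModuleCat.{u} A) (P : ProjectiveResolution M) :
    Subsingleton (((Ext A (ModuleCat.{u} A) 1).obj (Opposite.op M)).obj C) ↔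
    ∀ g : P.complex.X 1 ⟶ C, P.complex.d 2 1 ≫ g = 0 → ∃ h : P.complex.X 0 ⟶ C,
      P.complex.d 1 0 ≫ h = g := by
  rw [← ModuleCat.isZero_iff_subsingleton, (P.isoExt 1 C).isZero_iff,
    ← HomologicalComplex.exactAt_iff_isZero_homology,
    HomologicalComplex.exactAt_iff' _ 0 1 2 (by simp) (by simp),
    ShortComplex.moduleCat_exact_iff]
  rfl

lemma ext1_data (A : Type u) [CommRing A] (M : Type u) [AddCommGroup M] [Module A M] :
    ∃ (P₀ P₁ : ModuleCat.{u} A) (d : P₁ →ₗ[A] P₀) (p : P₀ →ₗ[A] M),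
      Module.Projective A P₀ ∧ Function.Surjective p ∧ Function.Exact d p ∧
      ∀ (C : Type u) [AddCommGroup C] [Module A C],
        Subsingleton (((Ext A (ModuleCat.{u} A) 1).obj
          (Opposite.op (ModuleCat.of A M))).obj (ModuleCat.of A C)) ↔
        ∀ g : P₁ →ₗ[A] C, (∀ x, d x = 0 → g x = 0) → ∃ h : P₀ →ₗ[A] C, ∀ x, h (d x) = g x := by
  let P := projectiveResolution (ModuleCat.of A M)
  have hep : Epi (P.π.f 0) := inferInstance
  refine ⟨P.complex.X 0, P.complex.X 1, (P.complex.d 1 0).hom, (P.π.f 0).hom, ?_, ?_, ?_, ?_⟩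
  · exact (IsProjective.iff_projective _).2 (P.projective 0)
  · exact (ModuleCat.epi_iff_surjective _).1 hep
  · exact (ShortComplex.ShortExact.moduleCat_exact_iff_function_exact _).1 P.exact₀
  · intro C _ _
    rw [ext1_iff _ _ P]
    have hex := (ShortComplex.ShortExact.moduleCat_exact_iff_function_exact _).1 (P.exact_succ 0)
    constructor
    · intro H g hg
      obtain ⟨h, hh⟩ := H (ModuleCat.ofHom g) (by
        ext x
        exact hg _ ((hex _).2 ⟨x, rfl⟩))
      exact ⟨h.hom, fun x => congrArg (fun q => q.hom x) hh⟩
    · intro H g hg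
      obtain ⟨h, hh⟩ := H g.hom (fun x hx => by
        obtain ⟨y, rfl⟩ := (hex x).1 hx
        exact congrArg (fun q => q.hom y) hg)
      exact ⟨ModuleCat.ofHom h, by ext x; exact hh x⟩

lemma cotorsion_char {A : Type u} [CommRing A] (I : Type u) [AddCommGroup I] [Module A I] :
    IsCotorsion A (CharacterModule I) := by
  intro F _ _ hF
  obtain ⟨P₀, P₁, d, p, -, hp, hex, H⟩ := ext1_data A F
  rw [H]
  intro g hg
  let ι := (LinearMap.range d).subtype
  have hι : Function.Injective (ι.rTensor I) := by
    rw [← LinearMap.lTensor_inj_iff_rTensor_inj]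
    refine LinearMap.lTensor_injective_of_exact_of_flat p hp ι (Submodule.injective_subtype _) ?_ I
    intro x
    rw [hex x]
    simp [ι]
  rw [rTensor_injective_iff_lcomp_surjective] at hι
  let g' : (P₁ ⧸ LinearMap.ker d) →ₗ[A] CharacterModule I :=
    (LinearMap.ker d).liftQ g (fun x hx => hg x hx)
  obtain ⟨h, hh⟩ := hι (g' ∘ₗ d.quotKerEquivRange.symm.toLinearMap)
  refine ⟨h, fun x => ?_⟩
  have := LinearMap.congr_fun hh (d.quotKerEquivRange (Submodule.Quotient.mk x))
  simp only [LinearMap.comp_apply, LinearEquiv.coe_coe, LinearEquiv.symm_apply_apply] at this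
  exact this

lemma cotorsion_split {A : Type u} [CommRing A] {C E : Type u} [AddCommGroup C] [Module A C]
    [AddCommGroup E] [Module A E] (hC : IsCotorsion A C) (i : C →ₗ[A] E)
    (hi : Function.Injective i) (hQ : Module.Flat A (E ⧸ LinearMap.range i)) :
    ∃ r : E →ₗ[A] C, ∀ c, r (i c) = c := by
  obtain ⟨P₀, P₁, d, p, hP, hp, hex, H⟩ := ext1_data A (E ⧸ LinearMap.range i)
  have H := (H C).1 (hC _ hQ)
  obtain ⟨l, hl⟩ := Module.projective_lifting_property (LinearMap.range i).mkQ p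
    (Submodule.mkQ_surjective _)
  have hl' : ∀ x, Submodule.Quotient.mk (l x) = p x := fun x => LinearMap.congr_fun hl x
  have hld : ∀ x, (l ∘ₗ d) x ∈ LinearMap.range i := fun x => by
    rw [← Submodule.Quotient.mk_eq_zero]
    exact (hl' _).trans ((hex _).2 ⟨x, rfl⟩)
  let e := LinearEquiv.ofInjective i hi
  have hei : ∀ y : LinearMap.range i, i (e.symm y) = y := fun y =>
    congrArg Subtype.val (e.apply_symm_apply y)
  let g : P₁ →ₗ[A] C := e.symm.toLinearMap ∘ₗ (l ∘ₗ d).codRestrict _ hld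
  have hg : ∀ x, i (g x) = l (d x) := fun x => hei _
  obtain ⟨h, hh⟩ := H g (fun x hx => hi (by rw [hg, hx]; simp))
  -- the section of the quotient map
  let s0 : P₀ →ₗ[A] E := l - i ∘ₗ h
  have hs0 : ∀ x, p x = 0 → s0 x = 0 := fun x hx => by
    obtain ⟨y, rfl⟩ := (hex x).1 hx
    simp [s0, hh, hg]
  -- retraction
  have hmem : ∀ x, (LinearMap.range i).mkQ (s0 x) = p x := fun x => by
    simp only [s0, LinearMap.sub_apply, map_sub, LinearMap.comp_apply, Submodule.mkQ_apply, hl']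
    rw [(Submodule.Quotient.mk_eq_zero (LinearMap.range i) (x := i (h x))).2 ⟨_, rfl⟩, sub_zero]
  let s : (E ⧸ LinearMap.range i) →ₗ[A] E :=
    ((LinearMap.ker p).liftQ s0 (fun x hx => hs0 x hx)) ∘ₗ
      (p.quotKerEquivOfSurjective hp).symm.toLinearMap
  have hs : ∀ x, s (p x) = s0 x := fun x => by
    have : (p.quotKerEquivOfSurjective hp).symm (p x) = Submodule.Quotient.mk x := by
      rw [LinearEquiv.symm_apply_eq]; rfl
    simp only [s, LinearMap.comp_apply, LinearEquiv.coe_coe, this]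
    rfl
  have hr : ∀ y, (LinearMap.id - s ∘ₗ (LinearMap.range i).mkQ : E →ₗ[A] E) y ∈ LinearMap.range i := fun y => by
    rw [← Submodule.Quotient.mk_eq_zero]
    obtain ⟨x, hx⟩ := hp (Submodule.Quotient.mk y)
    have h1 := hmem x
    rw [← hs, hx] at h1
    simp only [LinearMap.sub_apply, LinearMap.comp_apply, Submodule.mkQ_apply, LinearMap.id_apply,
      Submodule.Quotient.mk_sub] at h1 ⊢
    rw [h1, sub_self]
  refine ⟨e.symm.toLinearMap ∘ₗ LinearMap.codRestrict _ _ hr, fun c => hi ?_⟩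
  refine (hei _).trans ?_
  have : (Submodule.Quotient.mk (i c) : E ⧸ LinearMap.range i) = 0 :=
    (Submodule.Quotient.mk_eq_zero _).2 ⟨c, rfl⟩
  simp [this]

/-- Evaluation map to the double character module. -/
noncomputable def charEv (A : Type u) [CommRing A] (C : Type u) [AddCommGroup C] [Module A C] :
    C →ₗ[A] CharacterModule (CharacterModule C) where
  toFun c := AddMonoidHom.eval c
  map_add' x y := CharacterModule.ext _ fun φ => map_add φ x y
  map_smul' r x := CharacterModule.ext _ fun φ => rfl

lemma charEv_apply {A : Type u} [CommRing A] {C : Type u} [AddCommGroup C] [Module A C] (c : C)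
    (φ : CharacterModule C) : charEv A C c φ = φ c := rfl

lemma charEv_injective (A : Type u) [CommRing A] (C : Type u) [AddCommGroup C] [Module A C] :
    Function.Injective (charEv A C) := by
  rw [injective_iff_map_eq_zero]
  intro c hc
  exact CharacterModule.eq_zero_of_character_apply fun φ => DFunLike.congr_fun hc φ

lemma flat_coker_ev {A : Type u} [CommRing A] (C : Type u) [AddCommGroup C] [Module A C]
    (h : Module.Flat A (CharacterModule (CharacterModule C))) :
    Module.Flat A (CharacterModule (CharacterModule C) ⧸ LinearMap.range (charEv A C)) := by
  rw [Module.Flat.iff_characterModule_injective] at h ⊢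
  let q := (LinearMap.range (charEv A C)).mkQ
  let i := CharacterModule.dual q
  have hi : Function.Injective i :=
    CharacterModule.dual_injective_of_surjective _ (Submodule.mkQ_surjective _)
  have hex : Function.Exact i (CharacterModule.dual (charEv A C)) := by
    rw [exact_dual_iff]
    intro x
    simp [q]
  let t := LinearMap.id (R := A) - charEv A (CharacterModule C) ∘ₗ CharacterModule.dual (charEv A C)
  have ht : ∀ x, t x ∈ LinearMap.range i := fun x => by
    refine (hex _).1 ?_
    ext c
    change x (charEv A C c) - x (charEv A C c) = 0
    exact sub_self _
  let e := LinearEquiv.ofInjective i hi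
  have hte : ∀ y, t (i y) = i y := fun y => by
    have := (hex (i y)).2 ⟨y, rfl⟩
    simp [t, this]
  constructor
  intro X Y _ _ _ _ f hf g
  obtain ⟨k, hk⟩ := h.out f hf (i ∘ₗ g)
  refine ⟨(e.symm.toLinearMap ∘ₗ t.codRestrict _ ht) ∘ₗ k, fun x => ?_⟩
  simp only [LinearMap.comp_apply, LinearEquiv.coe_coe]
  rw [LinearEquiv.symm_apply_eq]
  refine Subtype.ext ?_
  change t (k (f x)) = i (g x)
  rw [hk]; exact hte _

end

/-- For a complex `F` of flat modules over a commutative noetherian ring `A`: `F` is acyclic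
with `F ⊗_A I` acyclic for every injective `I` iff `F` is acyclic with `Hom_A(F, C)` acyclic
for every cotorsion flat `C`. -/
theorem nTotallyAcyclic_iff_hom_cotorsionFlat_acyclic
    (A : Type u) [CommRing A] [IsNoetherianRing A]
    (X : ℤ → Type u) [∀ n, AddCommGroup (X n)] [∀ n, Module A (X n)]
    (d : ∀ n, X n →ₗ[A] X (n + 1)) (hflat : ∀ n, Module.Flat A (X n)) :
    ((∀ n, Function.Exact (d n) (d (n + 1))) ∧
      ∀ (I : Type u) [AddCommGroup I] [Module A I], Module.Injective A I →
        ∀ n, Function.Exact (LinearMap.rTensor I (d n)) (LinearMap.rTensor I (d (n + 1)))) ↔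
    ((∀ n, Function.Exact (d n) (d (n + 1))) ∧
      ∀ (C : Type u) [AddCommGroup C] [Module A C], IsCotorsionFlat A C →
        ∀ n, Function.Exact (LinearMap.lcomp A C (d (n + 1))) (LinearMap.lcomp A C (d n))) := by
  refine and_congr_right fun hX => ⟨fun H C _ _ hC n => ?_, fun H I _ _ hI n => ?_⟩
  · have hinj : Module.Injective A (CharacterModule C) :=
      Module.Flat.iff_characterModule_injective.1 hC.2
    obtain ⟨r, hr⟩ := cotorsion_split hC.1 (charEv A C) (charEv_injective A C)
      (flat_coker_ev C (flat_char hinj))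
    have hE := exact_lcomp_char_iff.2 (H _ hinj n)
    intro φ
    constructor
    · intro hφ
      obtain ⟨ψ, hψ⟩ := (hE (charEv A C ∘ₗ φ)).1 (by
        ext1 x
        have : φ (d n x) = 0 := LinearMap.congr_fun hφ x
        simp [LinearMap.lcomp_apply, this])
      refine ⟨r ∘ₗ ψ, ?_⟩
      ext x
      have := LinearMap.congr_fun hψ x
      exact (congrArg r this).trans (hr _)
    · rintro ⟨ψ, rfl⟩
      ext x
      change ψ (d (n + 1) (d n x)) = 0
      rw [(hX n _).2 ⟨x, rfl⟩, map_zero]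
  · exact exact_lcomp_char_iff.1 (H (CharacterModule I) ⟨cotorsion_char I, flat_char hI⟩ n)
end

section
/- Let A be a commutative noetherian ring and F a flat A-module. Then there exists an exact sequence of A-modules 0 → F → S^0 → S^1 → S^2 → ⋯ in which every S^i is cotorsion flat and every syzygy (i.e., every image of a differential, equivalently every kernel) is a flat A-module. -/
universe u

lemma exists_factor_of_ker_le {R : Type*} [CommRing R] {X Y Q : Type*} [AddCommGroup X] [Module R X]
    [AddCommGroup Y] [Module R Y] [AddCommGroup Q] [Module R Q] (hQ : Module.Baer R Q)
    (f : X →ₗ[R] Y) (g : X →ₗ[R] Q) (h : LinearMap.ker f ≤ LinearMap.ker g) :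
    ∃ k : Y →ₗ[R] Q, ∀ x, k (f x) = g x := by
  obtain ⟨k, hk⟩ := hQ.extension_property ((LinearMap.ker f).liftQ f le_rfl)
    (by
      rw [← LinearMap.ker_eq_bot]
      exact Submodule.ker_liftQ_eq_bot _ _ _ le_rfl)
    ((LinearMap.ker f).liftQ g h)
  refine ⟨k, fun x => ?_⟩
  have := congrArg (fun l => l (Submodule.Quotient.mk x)) hk
  simpa using this

lemma flat_char_of_injective {A : Type u} [CommRing A] [IsNoetherianRing A]
    {E : Type u} [AddCommGroup E] [Module A E] (hE : Module.Baer A E) :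
    Module.Flat A (CharacterModule E) := by
  apply Module.Flat.of_forall_isTrivialRelation
  intro l f x hx
  let φ : (Fin l → A) →ₗ[A] A := Fintype.linearCombination A f
  obtain ⟨k, b, hb⟩ := Submodule.fg_iff_exists_fin_generating_family.mp
    (IsNoetherian.noetherian (LinearMap.ker φ))
  have hbφ : ∀ j, φ (b j) = 0 := fun j => by
    have : b j ∈ LinearMap.ker φ := by rw [← hb]; exact Submodule.subset_span ⟨j, rfl⟩
    exact this
  let T : (Fin l → E) →ₗ[ℤ] (Fin k → E) :=
    { toFun := fun e j => ∑ i, b j i • e i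
      map_add' := fun e e' => by ext j; simp [Finset.sum_add_distrib]
      map_smul' := fun n e => by
        ext j
        simp only [Pi.smul_apply, Finset.smul_sum, RingHom.id_apply]
        exact Finset.sum_congr rfl fun i _ => smul_comm _ _ _ }
  let X : (Fin l → E) →ₗ[ℤ] AddCircle (1 : ℚ) :=
    { toFun := fun e => ∑ i, x i (e i)
      map_add' := fun e e' => by simp [Finset.sum_add_distrib]
      map_smul' := fun n e => by
        simp only [Pi.smul_apply, Finset.smul_sum, RingHom.id_apply]
        exact Finset.sum_congr rfl fun i _ => map_zsmul (x i) _ _ }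
  have hker : LinearMap.ker T ≤ LinearMap.ker X := by
    intro e he
    rw [LinearMap.mem_ker] at he ⊢
    have he' : ∀ j, ∑ i, b j i • e i = 0 := fun j => congrFun he j
    obtain ⟨h, hh⟩ := exists_factor_of_ker_le hE φ (Fintype.linearCombination A e) (by
      rw [← hb, Submodule.span_le]
      rintro _ ⟨j, rfl⟩
      simpa [Fintype.linearCombination_apply] using he' j)
    have hei : ∀ i, e i = f i • h 1 := fun i => by
      have := hh (Pi.single i 1)
      simp only [φ, Fintype.linearCombination_apply_single, one_smul] at this
      rw [← this, ← map_smul, smul_eq_mul, mul_one]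
    have h2 := congrArg (fun c : CharacterModule E => c (h 1)) hx
    have h3 : ∀ (s : Finset (Fin l)) (c : Fin l → CharacterModule E) (z : E),
        (∑ i ∈ s, c i) z = ∑ i ∈ s, c i z := fun s c z =>
      AddMonoidHom.finsetSum_apply c s z
    change ∑ i, x i (e i) = 0
    rw [h3] at h2
    simp only [CharacterModule.smul_apply] at h2
    simp only [hei]
    exact h2
  obtain ⟨Y, hY⟩ := exists_factor_of_ker_le
    (Module.Baer.of_divisible (AddCircle (1 : ℚ))) T X hker
  refine ⟨k, fun i j => b j i,
    fun j => (Y.toAddMonoidHom.comp (AddMonoidHom.single (fun _ : Fin k => E) j) : E →+ _), ?_, ?_⟩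
  · intro i
    ext z
    have h3 : ∀ (s : Finset (Fin k)) (c : Fin k → CharacterModule E) (z : E),
        (∑ i ∈ s, c i) z = ∑ i ∈ s, c i z := fun s c z =>
      AddMonoidHom.finsetSum_apply c s z
    have h4 := hY (Pi.single i z)
    have hX : X (Pi.single i z) = x i z := by
      change ∑ i', x i' ((Pi.single i z : Fin l → E) i') = _
      rw [Finset.sum_eq_single i]
      · simp
      · intro i' _ hne
        rw [Pi.single_eq_of_ne hne, map_zero]
      · simp
    have hT : T (Pi.single i z) = ∑ j, Pi.single j (b j i • z) := by
      rw [Finset.univ_sum_single (fun j => b j i • z)]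
      ext j
      change ∑ i', b j i' • (Pi.single i z : Fin l → E) i' = _
      rw [Finset.sum_eq_single i]
      · simp
      · intro i' _ hne
        rw [Pi.single_eq_of_ne hne, smul_zero]
      · simp
    rw [h3, ← hX, ← h4, hT, map_sum]
    rfl
  · intro j
    have := hbφ j
    simp only [φ, Fintype.linearCombination_apply, smul_eq_mul] at this
    rw [← this]
    exact Finset.sum_congr rfl fun i _ => mul_comm _ _

/-- evaluation -/
def charEval (A : Type u) [CommRing A] (M : Type u) [AddCommGroup M] [Module A M] :
    M →ₗ[A] CharacterModule (CharacterModule M) where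
  toFun m := (AddMonoidHom.eval m : (M →+ AddCircle (1 : ℚ)) →+ AddCircle (1 : ℚ))
  map_add' m m' := by
    ext c
    exact map_add c m m'
  map_smul' r m := by
    ext c
    rfl

lemma charEval_apply {A : Type u} [CommRing A] {M : Type u} [AddCommGroup M] [Module A M]
    (m : M) (c : CharacterModule M) : charEval A M m c = c m := rfl

lemma charEval_injective (A : Type u) [CommRing A] (M : Type u) [AddCommGroup M] [Module A M] :
    Function.Injective (charEval A M) := by
  rw [injective_iff_map_eq_zero]
  intro m hm
  apply CharacterModule.eq_zero_of_character_apply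
  intro c
  rw [← charEval_apply (A := A), hm]
  rfl

lemma flat_bidual {A : Type u} [CommRing A] [IsNoetherianRing A]
    {F : Type u} [AddCommGroup F] [Module A F] (hF : Module.Flat A F) :
    Module.Flat A (CharacterModule (CharacterModule F)) :=
  flat_char_of_injective (Module.Flat.iff_characterModule_baer.mp hF)

abbrev Cok (A : Type u) [CommRing A] (M : Type u) [AddCommGroup M] [Module A M] : Type u :=
  CharacterModule (CharacterModule M) ⧸ LinearMap.range (charEval A M)

lemma flat_cok {A : Type u} [CommRing A] [IsNoetherianRing A]
    {F : Type u} [AddCommGroup F] [Module A F] (hF : Module.Flat A F) :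
    Module.Flat A (Cok A F) := by
  have hB := Module.Flat.iff_characterModule_baer.mp (flat_bidual hF)
  rw [Module.Flat.iff_characterModule_baer]
  intro I g
  let π := (LinearMap.range (charEval A F)).mkQ
  obtain ⟨h, hh⟩ := hB I (CharacterModule.dual π ∘ₗ g)
  -- `h 1` corrected by the splitting
  let ψ := h 1
  let ψ' : CharacterModule (CharacterModule (CharacterModule F)) :=
    ψ - charEval A _ (CharacterModule.dual (charEval A F) ψ)
  obtain ⟨c, hc⟩ : ∃ c : CharacterModule (Cok A F), CharacterModule.dual π c = ψ' := by
    refine ⟨QuotientAddGroup.lift _ ψ' ?_, ?_⟩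
    · rintro _ ⟨x, rfl⟩
      change ψ _ - ψ _ = 0
      exact sub_self _
    · rfl
  refine ⟨LinearMap.toSpanSingleton A _ c, fun x hx => ?_⟩
  apply CharacterModule.dual_injective_of_surjective π (Submodule.mkQ_surjective _)
  rw [LinearMap.toSpanSingleton_apply, map_smul, hc]
  have h1 : x • ψ = CharacterModule.dual π (g ⟨x, hx⟩) := by
    rw [← map_smul, smul_eq_mul, mul_one]
    exact hh x hx
  change x • (ψ - _) = _
  rw [smul_sub, ← map_smul (charEval A _), ← map_smul (CharacterModule.dual _), h1]
  have h5 : CharacterModule.dual (charEval A F) (CharacterModule.dual π (g ⟨x, hx⟩)) = 0 := by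
    rw [← LinearMap.comp_apply (CharacterModule.dual (charEval A F)), ← CharacterModule.dual_comp]
    have : π ∘ₗ charEval A F = 0 := LinearMap.range_mkQ_comp _
    rw [this, CharacterModule.dual_zero, LinearMap.zero_apply]
  rw [h5, map_zero, sub_zero]

open CategoryTheory in
lemma isCotorsion_char (A : Type u) [CommRing A] (M : Type u) [AddCommGroup M] [Module A M] :
    IsCotorsion A (CharacterModule M) := by
  intro G _ _ hG
  let P := projectiveResolution (ModuleCat.of A G)
  have hz : Limits.IsZero (((Ext A (ModuleCat.{u} A) 1).obj
      (Opposite.op (ModuleCat.of A G))).obj (ModuleCat.of A (CharacterModule M))) := by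
    refine Limits.IsZero.of_iso ?_ (P.isoExt 1 _)
    rw [← HomologicalComplex.exactAt_iff_isZero_homology,
      HomologicalComplex.exactAt_iff' _ 0 1 2 (by simp) (by simp),
      ShortComplex.moduleCat_exact_iff]
    intro (f : P.complex.X 1 ⟶ _) hf
    replace hf : P.complex.d 2 1 ≫ f = 0 := hf
    have e1 := (ShortComplex.moduleCat_exact_iff _).mp (P.exact_succ 0)
    have e0 := (ShortComplex.moduleCat_exact_iff _).mp
      (ShortComplex.exact_of_g_is_cokernel
        (ShortComplex.mk _ _ P.complex_d_comp_π_f_zero) P.isColimitCokernelCofork)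
    let d1 : P.complex.X 1 →ₗ[A] P.complex.X 0 := (P.complex.d 1 0).hom
    let p : P.complex.X 0 →ₗ[A] G := (P.π.f 0).hom
    have hp : Function.Surjective p := (ModuleCat.epi_iff_surjective _).mp
      (inferInstanceAs (Epi (P.π.f 0)))
    have hex : Function.Exact (LinearMap.range d1).subtype p := by
      intro y
      constructor
      · intro hy
        obtain ⟨x, hx⟩ := e0 y hy
        exact ⟨⟨y, x, hx⟩, rfl⟩
      · rintro ⟨⟨_, x, rfl⟩, rfl⟩
        exact congrArg (fun k => k.hom x) P.complex_d_comp_π_f_zero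
    have hinj := LinearMap.lTensor_injective_of_exact_of_flat
      p hp (LinearMap.range d1).subtype (Submodule.subtype_injective _) hex M
    rw [LinearMap.lTensor_inj_iff_rTensor_inj, rTensor_injective_iff_lcomp_surjective] at hinj
    have hker : LinearMap.ker d1 ≤ LinearMap.ker f.hom := by
      intro x hx
      obtain ⟨y, hy⟩ := e1 x hx
      have := congrArg (fun k => k.hom y) hf
      change f.hom x = 0
      rw [← hy]
      exact this
    let f' : LinearMap.range d1 →ₗ[A] CharacterModule M :=
      ((LinearMap.ker d1).liftQ f.hom hker) ∘ₗ d1.quotKerEquivRange.symm.toLinearMap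
    have hf' : ∀ x, f' ⟨d1 x, x, rfl⟩ = f.hom x := by
      intro x
      have : d1.quotKerEquivRange.symm ⟨d1 x, x, rfl⟩ = Submodule.Quotient.mk x := by
        rw [LinearEquiv.symm_apply_eq]
        rfl
      simp [f', this]
    obtain ⟨g, hg⟩ := hinj f'
    refine ⟨(ModuleCat.ofHom g : P.complex.X 0 ⟶ _), ?_⟩
    change P.complex.d 1 0 ≫ ModuleCat.ofHom g = f
    ext x : 2
    rw [← hf', ← hg]
    rfl
  exact ModuleCat.subsingleton_of_isZero hz

/-- syzygies -/
def syz (A : Type u) [CommRing A] (F : ModuleCat.{u} A) : ℕ → ModuleCat.{u} A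
  | 0 => F
  | n + 1 => ModuleCat.of A (Cok A (syz A F n))

lemma flat_syz {A : Type u} [CommRing A] [IsNoetherianRing A]
    (F : ModuleCat.{u} A) (hF : Module.Flat A F) (n : ℕ) : Module.Flat A (syz A F n) := by
  induction n with
  | zero => exact hF
  | succ n ih => exact flat_cok ih

/-- projection to the next syzygy -/
def syzProj (A : Type u) [CommRing A] (F : ModuleCat.{u} A) (n : ℕ) :
    CharacterModule (CharacterModule (syz A F n)) →ₗ[A] syz A F (n + 1) :=
  (LinearMap.range (charEval A (syz A F n))).mkQ

lemma syzProj_surjective (A : Type u) [CommRing A] (F : ModuleCat.{u} A) (n : ℕ) :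
    Function.Surjective (syzProj A F n) := Submodule.mkQ_surjective _

lemma syz_exact (A : Type u) [CommRing A] (F : ModuleCat.{u} A) (n : ℕ) :
    Function.Exact (charEval A (syz A F n)) (syzProj A F n) :=
  LinearMap.exact_map_mkQ_range _

/-- Every flat module `F` over a commutative noetherian ring admits an exact coresolution
`0 → F → S⁰ → S¹ → ⋯` by cotorsion flat modules whose syzygies (images of the differentials)
are all flat. -/
theorem flat_cotorsionFlat_coresolution
    (A : Type u) [CommRing A] [IsNoetherianRing A]
    (F : Type u) [AddCommGroup F] [Module A F] (hF : Module.Flat A F) :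
    ∃ (S : ℕ → Type u) (_ : ∀ i, AddCommGroup (S i)) (_ : ∀ i, Module A (S i))
      (ι : F →ₗ[A] S 0) (d : ∀ i, S i →ₗ[A] S (i + 1)),
      (∀ i, IsCotorsionFlat A (S i)) ∧
      Function.Injective ι ∧ Function.Exact ι (d 0) ∧
      (∀ i, Function.Exact (d i) (d (i + 1))) ∧
      (∀ i, Module.Flat A ↥(LinearMap.range (d i))) := by
  let F' := ModuleCat.of A F
  have hex : ∀ i, Function.Exact (charEval A (syz A F' i))
      (charEval A (syz A F' (i + 1)) ∘ₗ syzProj A F' i) := by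
    intro i y
    rw [← syz_exact A F' i y, LinearMap.comp_apply, map_eq_zero_iff _ (charEval_injective A _)]
  refine ⟨fun i => CharacterModule (CharacterModule (syz A F' i)), fun i => inferInstance,
    fun i => inferInstance, charEval A (syz A F' 0),
    fun i => charEval A (syz A F' (i + 1)) ∘ₗ syzProj A F' i, ?_, charEval_injective A (syz A F' 0), hex 0,
    ?_, ?_⟩
  · exact fun i => ⟨isCotorsion_char A _, flat_bidual (flat_syz F' hF i)⟩
  · intro i y
    rw [hex (i + 1) y, LinearMap.coe_comp, (syzProj_surjective A F' i).range_comp]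
  · intro i
    have hr : LinearMap.range (charEval A (syz A F' (i + 1)) ∘ₗ syzProj A F' i) =
        LinearMap.range (charEval A (syz A F' (i + 1))) :=
      LinearMap.range_comp_of_range_eq_top _
        (LinearMap.range_eq_top.mpr (syzProj_surjective A F' i))
    have := flat_syz F' hF (i + 1)
    change Module.Flat A (LinearMap.range (charEval A (syz A F' (i + 1)) ∘ₗ syzProj A F' i))
    rw [hr]
    exact Module.Flat.of_linearEquiv
      (LinearEquiv.ofInjective _ (charEval_injective A (syz A F' (i + 1)))).symm
end

section
/- Let A be a commutative noetherian ring of finite Krull dimension and P a cochain complex of projective A-modules. If P is totally acyclic, then P is N-totally acyclic; that is, P ⊗_A I is acyclic for every injective A-module I. -/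
universe u

/-- A cochain complex `(X, d)` of projective `A`-modules is *totally acyclic* if it is acyclic
and `Hom_A(X, Q)` is acyclic for every projective `A`-module `Q`. -/
def IsTotallyAcyclic (A : Type u) [CommRing A] (X : ℤ → Type u)
    [∀ n, AddCommGroup (X n)] [∀ n, Module A (X n)]
    (d : ∀ n, X n →ₗ[A] X (n + 1)) : Prop :=
  (∀ n, Function.Exact (d n) (d (n + 1))) ∧
  ∀ (Q : Type u) [AddCommGroup Q] [Module A Q], Module.Projective A Q →
    ∀ n, Function.Exact (LinearMap.lcomp A Q (d (n + 1))) (LinearMap.lcomp A Q (d n))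

open CategoryTheory Abelian TensorProduct

def PD (R : Type u) [CommRing R] (n : ℕ) (M : Type u) [AddCommGroup M] [Module R M] : Prop :=
  HasProjectiveDimensionLT (ModuleCat.of R M) n

section
variable {R : Type u} [CommRing R] {M₁ M₂ M₃ : Type u} [AddCommGroup M₁] [Module R M₁]
  [AddCommGroup M₂] [Module R M₂] [AddCommGroup M₃] [Module R M₃]

lemma ses_mk (f : M₁ →ₗ[R] M₂) (g : M₂ →ₗ[R] M₃) (hf : Function.Injective f)
    (hg : Function.Surjective g) (h : Function.Exact f g) :
    (ShortComplex.mk (ModuleCat.ofHom f) (ModuleCat.ofHom g)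
      (by ext x; exact h.apply_apply_eq_zero x)).ShortExact where
  exact := by
    rw [ShortComplex.moduleCat_exact_iff]
    intro x hx
    exact (h x).1 hx
  mono_f := by rw [ModuleCat.mono_iff_injective]; exact hf
  epi_g := by rw [ModuleCat.epi_iff_surjective]; exact hg

lemma PD.ses₂ (f : M₁ →ₗ[R] M₂) (g : M₂ →ₗ[R] M₃) (hf : Function.Injective f)
    (hg : Function.Surjective g) (h : Function.Exact f g) {n : ℕ}
    (h₁ : PD R n M₁) (h₃ : PD R n M₃) : PD R n M₂ :=
  (ses_mk f g hf hg h).hasProjectiveDimensionLT_X₂ n h₁ h₃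

lemma PD.ses₃ (f : M₁ →ₗ[R] M₂) (g : M₂ →ₗ[R] M₃) (hf : Function.Injective f)
    (hg : Function.Surjective g) (h : Function.Exact f g) {n : ℕ}
    (h₁ : PD R n M₁) (h₂ : PD R (n+1) M₂) : PD R (n+1) M₃ :=
  (ses_mk f g hf hg h).hasProjectiveDimensionLT_X₃ n h₁ h₂

lemma PD.ses₁ (f : M₁ →ₗ[R] M₂) (g : M₂ →ₗ[R] M₃) (hf : Function.Injective f)
    (hg : Function.Surjective g) (h : Function.Exact f g) {n : ℕ}
    (h₂ : PD R n M₂) (h₃ : PD R (n+1) M₃) : PD R n M₁ :=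
  (ses_mk f g hf hg h).hasProjectiveDimensionLT_X₁ n h₂ h₃

lemma PD.of_equiv (e : M₁ ≃ₗ[R] M₂) {n : ℕ} (h : PD R n M₁) : PD R n M₂ :=
  have : HasProjectiveDimensionLT (ModuleCat.of R M₁) n := h
  hasProjectiveDimensionLT_of_iso (X := ModuleCat.of R M₁) (X' := ModuleCat.of R M₂) e.toModuleIso n

lemma PD.of_retract (i : M₁ →ₗ[R] M₂) (r : M₂ →ₗ[R] M₁) (hir : r ∘ₗ i = LinearMap.id) {n : ℕ}
    (h : PD R n M₂) : PD R n M₁ :=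
  have : HasProjectiveDimensionLT (ModuleCat.of R M₂) n := h
  Retract.hasProjectiveDimensionLT (X := ModuleCat.of R M₁) (Y := ModuleCat.of R M₂)
    ⟨ModuleCat.ofHom i, ModuleCat.ofHom r, by rw [← ModuleCat.ofHom_comp, hir]; rfl⟩ n

lemma PD.one_iff : PD R 1 M₁ ↔ Module.Projective R M₁ := by
  unfold PD
  rw [← projective_iff_hasProjectiveDimensionLT_one, ← IsProjective.iff_projective]

lemma PD.zero_iff : PD R 0 M₁ ↔ Subsingleton M₁ := by
  unfold PD
  rw [hasProjectiveDimensionLT_zero_iff_isZero, ModuleCat.isZero_of_iff_subsingleton]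

lemma PD.mono {n m : ℕ} (hnm : n ≤ m) (h : PD R n M₁) : PD R m M₁ :=
  have : HasProjectiveDimensionLT (ModuleCat.of R M₁) n := h
  hasProjectiveDimensionLT_of_ge _ n m hnm

/-- the free cover -/
noncomputable abbrev cov (R : Type u) [CommRing R] (M : Type u) [AddCommGroup M] [Module R M] :
    (M →₀ R) →ₗ[R] M := Finsupp.linearCombination R id

lemma cov_surj : Function.Surjective (cov R M₁) := Finsupp.linearCombination_id_surjective R M₁

lemma PD.syz {n : ℕ} (h : PD R (n+2) M₁) : PD R (n+1) (LinearMap.ker (cov R M₁)) :=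
  PD.ses₁ (LinearMap.ker (cov R M₁)).subtype (cov R M₁) (Submodule.subtype_injective _) cov_surj
    (LinearMap.exact_subtype_ker_map _) (PD.mono (Nat.le_add_left 1 n) (PD.one_iff.2 inferInstance)) h

lemma PD.of_syz {n : ℕ} (h : PD R (n+1) (LinearMap.ker (cov R M₁))) : PD R (n+2) M₁ :=
  PD.ses₃ (LinearMap.ker (cov R M₁)).subtype (cov R M₁) (Submodule.subtype_injective _) cov_surj
    (LinearMap.exact_subtype_ker_map _) h (PD.mono (by omega) (PD.one_iff.2 inferInstance))

end

/-- change of rings -/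
lemma PD.change {A : Type u} [CommRing A] (s : A) (hs : s ∈ nonZeroDivisors A) (n : ℕ) :
    ∀ (N : Type u) [AddCommGroup N] [Module A N] [Module (A ⧸ Ideal.span {s}) N]
      [IsScalarTower A (A ⧸ Ideal.span {s}) N], PD (A ⧸ Ideal.span {s}) n N → PD A (n+1) N := by
  have key : ∀ N : Type u, PD A 2 (N →₀ (A ⧸ Ideal.span {s})) := by
    intro N
    refine PD.ses₃ (LinearMap.lsmul A (N →₀ A) s)
      (Finsupp.mapRange.linearMap (Ideal.span {s}).mkQ) ?_ ?_ ?_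
      (PD.one_iff.2 inferInstance) (PD.mono one_le_two (PD.one_iff.2 inferInstance))
    · intro x y hxy
      ext i
      have := DFunLike.congr_fun hxy i
      simp only [LinearMap.lsmul_apply, Finsupp.smul_apply, smul_eq_mul] at this
      exact (mul_cancel_left_mem_nonZeroDivisors hs).1 this
    · exact Finsupp.mapRange_surjective _ (map_zero _) (Submodule.mkQ_surjective _)
    · intro x
      constructor
      · intro hx
        have h1 : ∀ i, ∃ a, s * a = x i := by
          intro i
          have := DFunLike.congr_fun hx i
          simp only [Finsupp.mapRange.linearMap_apply, Finsupp.mapRange_apply, Finsupp.zero_apply,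
            Submodule.mkQ_apply, Submodule.Quotient.mk_eq_zero, Ideal.mem_span_singleton'] at this
          obtain ⟨a, ha⟩ := this
          exact ⟨a, by rw [mul_comm, ha]⟩
        choose a ha using h1
        classical
        refine ⟨Finsupp.onFinset x.support (fun i => if x i = 0 then 0 else a i) ?_, ?_⟩
        · intro i hi; simp at hi ⊢; exact hi.1
        · ext i
          simp only [LinearMap.lsmul_apply, Finsupp.smul_apply, Finsupp.onFinset_apply, smul_eq_mul]
          split_ifs with h
          · simp [h]
          · exact ha i
      · rintro ⟨y, rfl⟩
        ext i
        simp only [Finsupp.mapRange.linearMap_apply, Finsupp.mapRange_apply, Finsupp.zero_apply,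
            Submodule.mkQ_apply, Submodule.Quotient.mk_eq_zero, Ideal.mem_span_singleton']
        exact ⟨y i, by simp [mul_comm]⟩
  induction n with
  | zero =>
    intro N _ _ _ _ h
    have := PD.zero_iff.1 h
    exact PD.mono (Nat.zero_le _) (PD.zero_iff.2 this)
  | succ n ih =>
    intro N _ _ _ _ h
    cases n with
    | zero =>
      have := PD.one_iff.1 h
      obtain ⟨t, ht⟩ := Module.projective_lifting_property (cov (A ⧸ Ideal.span {s}) N)
        LinearMap.id cov_surj
      refine PD.of_retract (t.restrictScalars A) ((cov (A ⧸ Ideal.span {s}) N).restrictScalars A) ?_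
        (key N)
      ext x
      exact LinearMap.congr_fun ht x
    | succ n =>
      have h1 := ih _ (PD.syz h)
      exact PD.ses₃ ((LinearMap.ker (cov (A ⧸ Ideal.span {s}) N)).subtype.restrictScalars A)
        ((cov (A ⧸ Ideal.span {s}) N).restrictScalars A) (Submodule.subtype_injective _) cov_surj
        (LinearMap.exact_subtype_ker_map (cov (A ⧸ Ideal.span {s}) N)) h1 (PD.mono (by omega) (key N))


section
variable {R : Type u} [CommRing R] {M₁ M₂ M₃ : Type u} [AddCommGroup M₁] [Module R M₁]
  [AddCommGroup M₂] [Module R M₂] [AddCommGroup M₃] [Module R M₃]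

lemma split_dual (f : M₁ →ₗ[R] M₂) (g : M₂ →ₗ[R] M₃) (hf : Function.Injective f)
    (hg : Function.Surjective g) (h : Function.Exact f g) [Module.Flat R M₃] :
    ∃ t : CharacterModule M₁ →ₗ[R] CharacterModule M₂,
      CharacterModule.dual f ∘ₗ t = LinearMap.id := by
  have hex : Function.Exact (CharacterModule.dual g) (CharacterModule.dual f) := by
    intro c
    constructor
    · intro hc
      have hker : g.toAddMonoidHom.ker ≤ AddMonoidHom.ker c := by
        intro x hx
        obtain ⟨y, rfl⟩ := (h x).1 hx
        exact DFunLike.congr_fun hc y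
      refine ⟨(g.toAddMonoidHom.liftOfSurjective hg) ⟨c, hker⟩, ?_⟩
      ext x
      exact AddMonoidHom.liftOfRightInverse_comp_apply g.toAddMonoidHom _
        (Function.rightInverse_surjInv hg) ⟨c, hker⟩ x
    · rintro ⟨c, rfl⟩
      ext x
      change c (g (f x)) = 0
      rw [h.apply_apply_eq_zero, map_zero]
  have hi := CharacterModule.dual_injective_of_surjective g hg
  have hs := CharacterModule.dual_surjective_of_injective f hf
  have hinj := Module.Flat.iff_characterModule_injective.1 (inferInstance : Module.Flat R M₃)
  obtain ⟨r, hr⟩ := hinj.out (CharacterModule.dual g) hi LinearMap.id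
  have h01 : (∃ l, CharacterModule.dual f ∘ₗ l = LinearMap.id) ↔
      (∃ l, l ∘ₗ CharacterModule.dual g = LinearMap.id) := (hex.split_tfae hi hs).out 0 1
  exact h01.2 ⟨r, LinearMap.ext hr⟩

lemma pure_of_flat (f : M₁ →ₗ[R] M₂) (g : M₂ →ₗ[R] M₃) (hf : Function.Injective f)
    (hg : Function.Surjective g) (h : Function.Exact f g) [Module.Flat R M₃]
    (N : Type u) [AddCommGroup N] [Module R N] : Function.Injective (f.lTensor N) := by
  obtain ⟨t, ht⟩ := split_dual f g hf hg h
  rw [← CharacterModule.dual_surjective_iff_injective]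
  intro c
  refine ⟨CharacterModule.homEquiv (t ∘ₗ CharacterModule.curry c), ?_⟩
  ext x
  induction x with
  | zero => exact (map_zero (AddMonoidHom.comp _ _)).trans (map_zero c).symm
  | add x y hx hy => rw [map_add, map_add, hx, hy]
  | tmul n m => exact DFunLike.congr_fun (LinearMap.congr_fun ht (CharacterModule.curry c n)) m

lemma flat_ker (f : M₁ →ₗ[R] M₂) (g : M₂ →ₗ[R] M₃) (hf : Function.Injective f)
    (hg : Function.Surjective g) (h : Function.Exact f g) [Module.Flat R M₃] [Module.Flat R M₂] :
    Module.Flat R M₁ := by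
  obtain ⟨t, ht⟩ := split_dual f g hf hg h
  have hinj := Module.Flat.iff_characterModule_injective.1 (inferInstance : Module.Flat R M₂)
  rw [Module.Flat.iff_characterModule_injective]
  constructor
  intro X Y _ _ _ _ i hi k
  obtain ⟨l, hl⟩ := hinj.out i hi (t ∘ₗ k)
  refine ⟨CharacterModule.dual f ∘ₗ l, fun x => ?_⟩
  rw [LinearMap.comp_apply, hl]
  exact LinearMap.congr_fun ht (k x)
end

/-- extensions with kernel killed by `I` split -/
def Good (A : Type u) [CommRing A] (F : Type u) [AddCommGroup F] [Module A F] (I : Ideal A) : Prop :=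
  ∀ (E : Type u) [AddCommGroup E] [Module A E] (π : E →ₗ[A] F), Function.Surjective π →
    (∀ a ∈ I, ∀ x, π x = 0 → a • x = 0) → ∃ t : F →ₗ[A] E, π ∘ₗ t = LinearMap.id

section
variable {A : Type u} [CommRing A] {F : Type u} [AddCommGroup F] [Module A F]

lemma good_of_proj [Module.Flat A F] (I : Ideal A)
    (hp : Module.Projective (A ⧸ I) ((A ⧸ I) ⊗[A] F)) : Good A F I := by
  intro E _ _ π hπ hI
  obtain ⟨σ, hσ⟩ := Module.projective_lifting_property (π.baseChange (A ⧸ I)) LinearMap.id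
    (LinearMap.lTensor_surjective _ hπ)
  have hex := lTensor_exact (A ⧸ I) (LinearMap.exact_subtype_ker_map π) hπ
  have hpure := pure_of_flat (LinearMap.ker π).subtype π (Submodule.subtype_injective _) hπ
    (LinearMap.exact_subtype_ker_map π) (A ⧸ I)
  -- `1 ⊗ k` determines `k`
  let mk (X : Type u) [AddCommGroup X] [Module A X] : X →ₗ[A] (A ⧸ I) ⊗[A] X :=
    TensorProduct.mk A (A ⧸ I) X 1
  have hmks : ∀ (X : Type u) [AddCommGroup X] [Module A X], Function.Surjective (mk X) := by
    intro X _ _ z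
    induction z with
    | zero => exact ⟨0, map_zero _⟩
    | add x y hx hy =>
      obtain ⟨x, rfl⟩ := hx
      obtain ⟨y, rfl⟩ := hy
      exact ⟨x + y, map_add _ _ _⟩
    | tmul a x =>
      obtain ⟨a, rfl⟩ := Ideal.Quotient.mk_surjective a
      refine ⟨a • x, ?_⟩
      change (1 : A ⧸ I) ⊗ₜ[A] (a • x) = _
      rw [← TensorProduct.smul_tmul]
      congr 1
      rw [Algebra.smul_def, mul_one]; rfl
  have hmki : Function.Injective (mk (LinearMap.ker π)) := by
    rw [injective_iff_map_eq_zero]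
    intro k hk
    have h1 : quotTensorEquivQuotSMul (LinearMap.ker π) I (Ideal.Quotient.mk I 1 ⊗ₜ[A] k) = 0 := by
      rw [map_one]; exact (LinearEquiv.map_eq_zero_iff _).2 hk
    rw [quotTensorEquivQuotSMul_mk_tmul, one_smul, Submodule.Quotient.mk_eq_zero] at h1
    have h2 : (I • ⊤ : Submodule A (LinearMap.ker π)) = ⊥ := by
      rw [eq_bot_iff, Submodule.smul_le]
      intro a ha x _
      rw [Submodule.mem_bot]
      exact Subtype.ext (hI a ha x x.2)
    rwa [h2] at h1
  have hnat : ∀ e, (π.lTensor (A ⧸ I)) (mk E e) = mk F (π e) := fun e => LinearMap.lTensor_tmul ..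
  have hnat' : ∀ k, ((LinearMap.ker π).subtype.lTensor (A ⧸ I)) (mk _ k) = mk E k :=
    fun e => LinearMap.lTensor_tmul ..
  let τ : E →ₗ[A] F × ((A ⧸ I) ⊗[A] E) := π.prod (mk E)
  have hτ : Function.Injective τ := by
    rw [injective_iff_map_eq_zero]
    intro e he
    have h1 : π e = 0 := congrArg Prod.fst he
    have h2 : mk E e = 0 := congrArg Prod.snd he
    have h3 := hnat' ⟨e, h1⟩
    rw [h2] at h3
    have h4 := hmki ((hpure (h3.trans (map_zero _).symm)).trans (map_zero _).symm)
    exact congrArg Subtype.val h4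
  let ρ : F →ₗ[A] F × ((A ⧸ I) ⊗[A] E) := LinearMap.id.prod (σ.restrictScalars A ∘ₗ mk F)
  have hρ : ∀ x, ∃ e, τ e = ρ x := by
    intro x
    obtain ⟨e, rfl⟩ := hπ x
    have h1 : (π.lTensor (A ⧸ I)) (mk E e - σ (mk F (π e))) = 0 := by
      rw [map_sub, hnat, sub_eq_zero]
      exact (LinearMap.congr_fun hσ (mk F (π e))).symm
    obtain ⟨z, hz⟩ := (hex _).1 h1
    obtain ⟨k, rfl⟩ := hmks _ z
    rw [hnat'] at hz
    refine ⟨e - k, Prod.ext ?_ ?_⟩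
    · change π (e - k) = π e
      rw [map_sub, k.2, sub_zero]
    · change mk E (e - k) = σ (mk F (π e))
      rw [map_sub, hz, sub_sub_cancel]
  refine ⟨(LinearEquiv.ofInjective τ hτ).symm.toLinearMap ∘ₗ
    ρ.codRestrict (LinearMap.range τ) hρ, ?_⟩
  ext x
  obtain ⟨e, he⟩ := hρ x
  have : (LinearEquiv.ofInjective τ hτ).symm (ρ.codRestrict (LinearMap.range τ) hρ x) = e := by
    rw [LinearEquiv.symm_apply_eq]
    exact Subtype.ext he.symm
  change π ((LinearEquiv.ofInjective τ hτ).symm (ρ.codRestrict (LinearMap.range τ) hρ x)) = x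
  rw [this]
  exact congrArg Prod.fst he

lemma good_mul {I J : Ideal A} (hI : Good A F I) (hJ : Good A F J) : Good A F (I * J) := by
  intro E _ _ π hπ h
  -- quotient by `J • ker`
  let K : Submodule A E := I • LinearMap.ker π
  have hK : K ≤ LinearMap.ker π := Submodule.smul_le_right
  obtain ⟨t, ht⟩ := hI (E ⧸ K) (K.liftQ π hK)
    (fun x => by obtain ⟨e, rfl⟩ := hπ x; exact ⟨K.mkQ e, by simp⟩) (by
      intro a ha x hx
      obtain ⟨x, rfl⟩ := K.mkQ_surjective x
      simp only [Submodule.mkQ_apply, Submodule.liftQ_apply] at hx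
      rw [← map_smul, Submodule.mkQ_apply, Submodule.Quotient.mk_eq_zero]
      exact Submodule.smul_mem_smul ha hx)
  let E' : Submodule A E := (LinearMap.range t).comap K.mkQ
  obtain ⟨t', ht'⟩ := hJ E' (π ∘ₗ E'.subtype) (by
      intro x
      obtain ⟨e, he⟩ := K.mkQ_surjective (t x)
      refine ⟨⟨e, ⟨x, he.symm⟩⟩, ?_⟩
      have := LinearMap.congr_fun ht x
      simp only [LinearMap.comp_apply, ← he] at this
      simpa using this) (by
      rintro a ha ⟨x, y, hy⟩ hx
      have hx : π x = 0 := hx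
      have h0 : y = 0 := by
        have := LinearMap.congr_fun ht y
        simp only [LinearMap.comp_apply, hy] at this
        simpa [hx] using this.symm
      have hxK : x ∈ K := by
        rw [h0, map_zero] at hy
        rwa [← Submodule.Quotient.mk_eq_zero, eq_comm]
      apply Subtype.ext
      change a • x = 0
      refine Submodule.smul_induction_on hxK ?_ ?_
      · intro r hr n hn
        rw [smul_smul, mul_comm]
        exact h _ (Ideal.mul_mem_mul hr ha) n hn
      · intro x y hx hy
        rw [smul_add, hx, hy, add_zero])
  exact ⟨E'.subtype ∘ₗ t', by rw [← LinearMap.comp_assoc, ht']⟩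

lemma proj_of_good (h : Good A F ⊥) : Module.Projective A F :=
  Module.Projective.of_lifting_property'' fun f hf => h _ f hf (by
    rintro a ha x -
    rw [(Submodule.mem_bot A).1 ha, zero_smul])

lemma good_prod (Z : Multiset (PrimeSpectrum A)) (h : ∀ p : PrimeSpectrum A, Good A F p.asIdeal) :
    Good A F (Z.map PrimeSpectrum.asIdeal).prod := by
  induction Z using Multiset.induction_on with
  | empty =>
    intro E _ _ π hπ hI
    have hi : Function.Injective π := by
      rw [injective_iff_map_eq_zero]
      intro x hx
      have := hI 1 (by simp) x hx
      rwa [one_smul] at this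
    exact ⟨(LinearEquiv.ofBijective π ⟨hi, hπ⟩).symm.toLinearMap, by
      ext x; exact LinearEquiv.apply_symm_apply (LinearEquiv.ofBijective π ⟨hi, hπ⟩) x⟩
  | cons p Z ih =>
    rw [Multiset.map_cons, Multiset.prod_cons]
    exact good_mul (h p) ih

lemma PD.of_primes [IsNoetherianRing A] (n : ℕ) : ∀ (F : Type u) [AddCommGroup F] [Module A F]
    [Module.Flat A F], (∀ p : PrimeSpectrum A, PD (A ⧸ p.asIdeal) (n+1) ((A ⧸ p.asIdeal) ⊗[A] F)) →
    PD A (n+1) F := by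
  induction n with
  | zero =>
    intro F _ _ _ h
    rw [PD.one_iff]
    obtain ⟨Z, hZ⟩ := PrimeSpectrum.exists_primeSpectrum_prod_le A ⊥
    apply proj_of_good
    rw [← le_bot_iff.1 hZ]
    exact good_prod Z fun p => good_of_proj _ (PD.one_iff.1 (h p))
  | succ n ih =>
    intro F _ _ _ h
    apply PD.of_syz
    have hfl : Module.Flat A (LinearMap.ker (cov A F)) :=
      @flat_ker A _ (LinearMap.ker (cov A F)) (F →₀ A) F _ _ _ _ _ _
        (LinearMap.ker (cov A F)).subtype
        (cov A F) (Submodule.subtype_injective _) cov_surj (LinearMap.exact_subtype_ker_map _) _ _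
    apply ih
    intro p
    refine PD.ses₁ ((LinearMap.ker (cov A F)).subtype.baseChange (A ⧸ p.asIdeal))
      ((cov A F).baseChange (A ⧸ p.asIdeal)) ?_ ?_ ?_
      (PD.mono (Nat.le_add_left 1 n) (PD.one_iff.2 inferInstance)) (h p)
    · exact pure_of_flat _ (cov A F) (Submodule.subtype_injective _) cov_surj
        (LinearMap.exact_subtype_ker_map _) _
    · exact LinearMap.lTensor_surjective _ cov_surj
    · exact lTensor_exact _ (LinearMap.exact_subtype_ker_map _) cov_surj
end


/-- vanishing of Ext -/
def Van (A : Type u) [CommRing A] (n : ℕ) (T Y : Type u) [AddCommGroup T] [Module A T]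
    [AddCommGroup Y] [Module A Y] : Prop :=
  Subsingleton (Ext.{u} (ModuleCat.of A T) (ModuleCat.of A Y) (n+1))

/-- lifting property -/
def Lft (A : Type u) [CommRing A] (T : Type u) [AddCommGroup T] [Module A T] {J Y : Type u}
    [AddCommGroup J] [Module A J] [AddCommGroup Y] [Module A Y] (π : J →ₗ[A] Y) : Prop :=
  ∀ f : T →ₗ[A] Y, ∃ g : T →ₗ[A] J, π ∘ₗ g = f

lemma van_shift (A : Type u) [CommRing A] (Y : Type u) [AddCommGroup Y] [Module A Y] :
    ∃ (J Y' : Type u) (_ : AddCommGroup J) (_ : Module A J) (_ : AddCommGroup Y') (_ : Module A Y')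
      (π : J →ₗ[A] Y'), Module.Injective A J ∧
      (∀ (T : Type u) [AddCommGroup T] [Module A T], Van A 0 T Y ↔ Lft A T π) ∧
      (∀ (n : ℕ) (T : Type u) [AddCommGroup T] [Module A T], Van A (n+1) T Y ↔ Van A n T Y') := by
  let J₀ : ModuleCat.{u} A := Injective.under (ModuleCat.of A Y)
  let ι : Y →ₗ[A] J₀ := (Injective.ι (ModuleCat.of A Y)).hom
  have hι : Function.Injective ι := (ModuleCat.mono_iff_injective _).1 inferInstance
  have hJ : Injective (ModuleCat.of A J₀) := inferInstanceAs (Injective (Injective.under (ModuleCat.of A Y)))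
  have hS := ses_mk ι (LinearMap.range ι).mkQ hι (Submodule.mkQ_surjective _)
    (LinearMap.exact_map_mkQ_range ι)
  refine ⟨J₀, J₀ ⧸ LinearMap.range ι, inferInstance, inferInstance, inferInstance, inferInstance,
    (LinearMap.range ι).mkQ, (Module.injective_iff_injective_object A J₀).2 hJ, ?_, ?_⟩
  · intro T _ _
    constructor
    · intro h f
      obtain ⟨x, hx⟩ := Ext.covariant_sequence_exact₃ (ModuleCat.of A T) hS
        (Ext.mk₀ (ModuleCat.ofHom f)) (zero_add 1) (@Subsingleton.elim _ h _ _)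
      obtain ⟨g, rfl⟩ := (Ext.mk₀_bijective _ _).2 x
      rw [Ext.mk₀_comp_mk₀] at hx
      have h2 := (Ext.mk₀_bijective _ _).1 hx
      exact ⟨g.hom, by ext x; exact congrArg (fun q => q.hom x) h2⟩
    · intro h
      refine subsingleton_of_forall_eq 0 fun x => ?_
      obtain ⟨y, rfl⟩ := Ext.covariant_sequence_exact₁ (ModuleCat.of A T) hS x
        (Ext.eq_zero_of_injective _) (zero_add 1)
      obtain ⟨f, rfl⟩ := (Ext.mk₀_bijective _ _).2 y
      obtain ⟨g, hg⟩ := h f.hom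
      have : f = ModuleCat.ofHom g ≫ ModuleCat.ofHom (LinearMap.range ι).mkQ := by
        ext x; exact (LinearMap.congr_fun hg x).symm
      rw [this, ← Ext.mk₀_comp_mk₀, Ext.comp_assoc_of_second_deg_zero]
      have h3 := hS.comp_extClass
      erw [h3, Ext.comp_zero]
  · intro n T _ _
    constructor
    · intro h
      refine subsingleton_of_forall_eq 0 fun x => ?_
      obtain ⟨y, rfl⟩ := Ext.covariant_sequence_exact₃ (ModuleCat.of A T) hS x rfl
        (@Subsingleton.elim _ h _ _)
      rw [Ext.eq_zero_of_injective y, Ext.zero_comp]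
    · intro h
      refine subsingleton_of_forall_eq 0 fun x => ?_
      obtain ⟨y, rfl⟩ := Ext.covariant_sequence_exact₁ (ModuleCat.of A T) hS x
        (Ext.eq_zero_of_injective _) rfl
      rw [@Subsingleton.elim _ h y 0, Ext.zero_comp]

lemma PD.van {A : Type u} [CommRing A] {n : ℕ} {T : Type u} [AddCommGroup T] [Module A T]
    (h : PD A (n+1) T) (Y : Type u) [AddCommGroup Y] [Module A Y] : Van A n T Y :=
  have : HasProjectiveDimensionLT (ModuleCat.of A T) (n+1) := h
  subsingleton_of_forall_eq 0 fun x => x.eq_zero_of_hasProjectiveDimensionLT (n+1) le_rfl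

lemma PD.of_van {A : Type u} [CommRing A] {n : ℕ} {T : Type u} [AddCommGroup T] [Module A T]
    (h : ∀ (Y : Type u) [AddCommGroup Y] [Module A Y], Van A n T Y) : PD A (n+1) T :=
  hasProjectiveDimensionLT_of_enoughInjectives.{u} _ _ fun Y => h Y

section
variable {A : Type u} [CommRing A] {V : Type u} [AddCommGroup V] [Module A V]

lemma eklof0 (Φ : Submodule A V → Prop)
    (hΦ : ∀ c : Set (Submodule A V), c.Nonempty → DirectedOn (· ≤ ·) c → (∀ N ∈ c, Φ N) → Φ (sSup c))
    (N₀ : Submodule A V) (h0 : Φ N₀) {J Y : Type u}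
    [AddCommGroup J] [Module A J] [AddCommGroup Y] [Module A Y] (π : J →ₗ[A] Y)
    (hJ : Module.Injective A J)
    (step : ∀ N, Φ N → N₀ ≤ N → N ≠ ⊤ → ∃ N', N < N' ∧ Φ N' ∧ Lft A (N' ⧸ N.submoduleOf N') π) :
    Lft A (V ⧸ N₀) π := by
  intro f
  let S : Set (V →ₗ.[A] J) := {g | Φ g.domain ∧ N₀ ≤ g.domain ∧
    (∀ x : g.domain, π (g x) = f (N₀.mkQ x)) ∧ ∀ x : g.domain, (x : V) ∈ N₀ → g x = 0}
  obtain ⟨g, -, hgS, hmax⟩ := zorn_le_nonempty₀ S (by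
    intro c hcS hc y hy
    have hd := hc.directedOn
    refine ⟨LinearPMap.sSup c hd, ⟨?_, ?_, ?_, ?_⟩, fun z hz => LinearPMap.le_sSup hd hz⟩
    · rw [LinearPMap.domain_sSup]
      apply hΦ _ (Set.Nonempty.image _ ⟨y, hy⟩) (DirectedOn.mono_comp LinearPMap.domain_mono.monotone hd)
      rintro _ ⟨z, hz, rfl⟩
      exact (hcS hz).1
    · exact (hcS hy).2.1.trans (LinearPMap.le_sSup hd hy).1
    · rintro ⟨x, hx⟩
      obtain ⟨l, hl, hxl⟩ := (LinearPMap.mem_domain_sSup_iff ⟨y, hy⟩ hd).1 hx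
      have := LinearPMap.sSup_apply hd hl ⟨x, hxl⟩
      rw [this]
      exact (hcS hl).2.2.1 ⟨x, hxl⟩
    · rintro ⟨x, hx⟩ hx0
      obtain ⟨l, hl, hxl⟩ := (LinearPMap.mem_domain_sSup_iff ⟨y, hy⟩ hd).1 hx
      have := LinearPMap.sSup_apply hd hl ⟨x, hxl⟩
      rw [this]
      exact (hcS hl).2.2.2 ⟨x, hxl⟩ hx0) ⟨N₀, 0⟩ ⟨h0, le_rfl, by
        intro x
        have : N₀.mkQ (x : V) = 0 := by simp
        rw [this, map_zero]
        exact map_zero π, fun _ _ => rfl⟩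
  obtain ⟨hg1, hg2, hg3, hg4⟩ := hgS
  have htop : g.domain = ⊤ := by
    by_contra hne
    obtain ⟨N', hlt, hN', hl⟩ := step g.domain hg1 hg2 hne
    obtain ⟨g₁, hg₁⟩ := hJ.out (Submodule.inclusion hlt.le) (Submodule.inclusion_injective _) g.toFun
    let e : N' →ₗ[A] Y := f ∘ₗ N₀.mkQ ∘ₗ N'.subtype - π ∘ₗ g₁
    have he : g.domain.submoduleOf N' ≤ LinearMap.ker e := by
      rintro ⟨x, hx'⟩ hx
      have hx : x ∈ g.domain := hx
      have h1 := hg₁ ⟨x, hx⟩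
      have h2 := hg3 ⟨x, hx⟩
      change f (N₀.mkQ x) - π (g₁ ⟨x, hx'⟩) = 0
      rw [← h2, sub_eq_zero]
      exact congrArg π h1.symm
    obtain ⟨h, hh⟩ := hl ((g.domain.submoduleOf N').liftQ e he)
    let G : V →ₗ.[A] J := ⟨N', g₁ + h ∘ₗ (g.domain.submoduleOf N').mkQ⟩
    have hGe : ∀ (x : V) (hx : x ∈ g.domain), G ⟨x, hlt.le hx⟩ = g ⟨x, hx⟩ := by
      intro x hx
      change g₁ ⟨x, hlt.le hx⟩ + h ((g.domain.submoduleOf N').mkQ ⟨x, hlt.le hx⟩) = _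
      have : (g.domain.submoduleOf N').mkQ ⟨x, hlt.le hx⟩ = 0 := by
        rw [Submodule.mkQ_apply, Submodule.Quotient.mk_eq_zero]; exact hx
      rw [this, map_zero, add_zero]
      exact hg₁ ⟨x, hx⟩
    have hle : g ≤ G := ⟨hlt.le, by
      rintro ⟨x, hx⟩ ⟨y, hy⟩ hxy
      obtain rfl : x = y := hxy
      exact (hGe x hx).symm⟩
    have hGS : G ∈ S := by
      refine ⟨hN', hg2.trans hlt.le, ?_, ?_⟩
      · rintro x
        change π (g₁ x + h ((g.domain.submoduleOf N').mkQ x)) = _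
        have h1 := LinearMap.congr_fun hh ((g.domain.submoduleOf N').mkQ x)
        change π (h ((g.domain.submoduleOf N').mkQ x)) = f (N₀.mkQ x) - π (g₁ x) at h1
        rw [map_add, h1]
        exact add_sub_cancel _ _
      · rintro ⟨x, hx⟩ hx0
        exact (hGe x (hg2 hx0)).trans (hg4 ⟨x, hg2 hx0⟩ hx0)
    exact absurd (hmax hGS hle).1 (not_le_of_gt hlt)
  let G : V →ₗ[A] J := g.toFun ∘ₗ LinearMap.codRestrict g.domain LinearMap.id (fun x => by rw [htop]; trivial)
  have hG0 : N₀ ≤ LinearMap.ker G := fun x hx => hg4 ⟨x, hg2 hx⟩ hx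
  refine ⟨N₀.liftQ G hG0, ?_⟩
  ext x
  exact hg3 ⟨x, _⟩

lemma eklof (Φ : Submodule A V → Prop)
    (hΦ : ∀ c : Set (Submodule A V), c.Nonempty → DirectedOn (· ≤ ·) c → (∀ N ∈ c, Φ N) → Φ (sSup c))
    (N₀ : Submodule A V) (h0 : Φ N₀) (n : ℕ) : ∀ (Y : Type u)
    [AddCommGroup Y] [Module A Y]
    (_ : ∀ N, Φ N → N₀ ≤ N → N ≠ ⊤ → ∃ N', N < N' ∧ Φ N' ∧ Van A n (N' ⧸ N.submoduleOf N') Y),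
    Van A n (V ⧸ N₀) Y := by
  induction n with
  | zero =>
    intro Y _ _ step
    obtain ⟨J, Y', _, _, _, _, π, hJ, h1, -⟩ := van_shift A Y
    rw [h1]
    simp only [h1] at step
    exact eklof0 Φ hΦ N₀ h0 π hJ step
  | succ n ih =>
    intro Y _ _ step
    obtain ⟨J, Y', _, _, _, _, π, hJ, -, h2⟩ := van_shift A Y
    rw [h2]
    simp only [h2] at step
    exact ih Y' step

lemma flat_sSup (c : Set (Submodule A V)) (hne : c.Nonempty) (hd : DirectedOn (· ≤ ·) c)
    (h : ∀ N ∈ c, Module.Flat A N) : Module.Flat A (sSup c : Submodule A V) := by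
  refine Module.Flat.of_forall_isTrivialRelation ?_
  intro l f x hx
  have hfin : ∀ s : Finset (Fin l), ∃ N ∈ c, ∀ i ∈ s, (x i : V) ∈ N := by
    intro s
    induction s using Finset.induction_on with
    | empty => obtain ⟨N, hN⟩ := hne; exact ⟨N, hN, by simp⟩
    | insert a s _ ih =>
      obtain ⟨N, hN, hs⟩ := ih
      obtain ⟨N₁, hN₁, ha⟩ := (Submodule.mem_sSup_of_directed hne hd).1 (x a).2
      obtain ⟨N₂, hN₂, h1, h2⟩ := hd N hN N₁ hN₁
      refine ⟨N₂, hN₂, ?_⟩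
      intro i hi
      rcases Finset.mem_insert.1 hi with rfl | hi
      · exact h2 ha
      · exact h1 (hs i hi)
  obtain ⟨N, hN, hxN⟩ := hfin Finset.univ
  have := h N hN
  have hle : N ≤ sSup c := le_sSup hN
  have hinj : ∑ i, f i • (⟨x i, hxN i (Finset.mem_univ i)⟩ : N) = 0 := by
    apply Subtype.ext
    have := congrArg Subtype.val hx
    simpa using this
  obtain ⟨k, a, y, h1, h2⟩ := Module.Flat.isTrivialRelation_of_sum_smul_eq_zero hinj
  refine ⟨k, a, fun j => ⟨y j, hle (y j).2⟩, ?_, h2⟩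
  intro i
  apply Subtype.ext
  have := congrArg Subtype.val (h1 i)
  simpa using this
end


section
variable {A : Type u} [CommRing A] {V : Type u} [AddCommGroup V] [Module A V]

lemma lemD [IsDomain A] (n : ℕ)
    (H : ∀ s : A, s ≠ 0 → ∀ (M : Type u) [AddCommGroup M] [Module (A ⧸ Ideal.span {s}) M],
      Module.Flat (A ⧸ Ideal.span {s}) M → PD (A ⧸ Ideal.span {s}) n M)
    (hV : ∀ s : A, s ≠ 0 → Function.Bijective (fun v : V => s • v))
    (N₀ : Submodule A V) (hfl : Module.Flat A N₀) (hN₀ : ∀ v : V, ∃ s : A, s ≠ 0 ∧ s • v ∈ N₀) :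
    PD A (n+1) (V ⧸ N₀) := by
  refine PD.of_van fun Y _ _ => eklof (fun N => Module.Flat A N) flat_sSup N₀ hfl n Y ?_
  intro N hN hle hne
  obtain ⟨v, hv⟩ : ∃ v, v ∉ N := by
    by_contra hcon
    push Not at hcon
    exact hne (eq_top_iff.2 fun x _ => hcon x)
  obtain ⟨s, hs, hsv⟩ := hN₀ v
  let N' : Submodule A V := N.comap (LinearMap.lsmul A V s)
  have hNN' : N ≤ N' := fun x hx => N.smul_mem s hx
  let e₀ : N' →ₗ[A] N := (LinearMap.lsmul A V s).restrict (fun x hx => hx)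
  have he₀ : Function.Bijective e₀ := by
    constructor
    · intro x y hxy
      exact Subtype.ext ((hV s hs).1 (congrArg Subtype.val hxy))
    · rintro ⟨y, hy⟩
      obtain ⟨x, hx⟩ := (hV s hs).2 y
      have hx : s • x = y := hx
      exact ⟨⟨x, by change s • x ∈ N; rwa [hx]⟩, Subtype.ext hx⟩
  let e : N' ≃ₗ[A] N := LinearEquiv.ofBijective e₀ he₀
  refine ⟨N', lt_of_le_of_ne hNN' ?_, Module.Flat.of_linearEquiv e, PD.van ?_ Y⟩
  · intro heq
    exact hv (heq ▸ (show v ∈ N' from hle hsv))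
  · have hmap : (N.submoduleOf N').map e.toLinearMap = (Ideal.span {s} • ⊤ : Submodule A N) := by
      ext ⟨y, hy⟩
      rw [Submodule.ideal_span_singleton_smul, Submodule.mem_smul_pointwise_iff_exists]
      constructor
      · rintro ⟨⟨x, hx'⟩, hx, hxy⟩
        exact ⟨⟨x, hx⟩, trivial, Subtype.ext (congrArg Subtype.val hxy)⟩
      · rintro ⟨⟨x, hx⟩, -, hxy⟩
        exact ⟨⟨x, hNN' hx⟩, hx, Subtype.ext (congrArg Subtype.val hxy)⟩
    have e2 : ((A ⧸ Ideal.span {s}) ⊗[A] N) ≃ₗ[A] (N' ⧸ N.submoduleOf N') :=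
      (quotTensorEquivQuotSMul N (Ideal.span {s})).trans
        (Submodule.Quotient.equiv _ _ e hmap).symm
    refine PD.of_equiv e2 (PD.change s (mem_nonZeroDivisors_of_ne_zero hs) n _ (H s hs _ inferInstance))

lemma flat_domain [IsDomain A] (n : ℕ)
    (H : ∀ s : A, s ≠ 0 → ∀ (M : Type u) [AddCommGroup M] [Module (A ⧸ Ideal.span {s}) M],
      Module.Flat (A ⧸ Ideal.span {s}) M → PD (A ⧸ Ideal.span {s}) n M)
    (F : Type u) [AddCommGroup F] [Module A F] [Module.Flat A F] : PD A (n+1) F := by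
  let K := Localization (nonZeroDivisors A)
  let _ : Field K := inferInstanceAs (Field (FractionRing A))
  let V := LocalizedModule (nonZeroDivisors A) F
  have hV : ∀ s : A, s ≠ 0 → Function.Bijective (fun v : V => s • v) := by
    intro s hs
    exact (Module.End.isUnit_iff _).1 (IsLocalizedModule.map_units
      (LocalizedModule.mkLinearMap (nonZeroDivisors A) F) ⟨s, mem_nonZeroDivisors_of_ne_zero hs⟩)
  let i : F →ₗ[A] V := LocalizedModule.mkLinearMap (nonZeroDivisors A) F
  have hi : Function.Injective i := by
    rw [injective_iff_map_eq_zero]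
    intro x hx
    obtain ⟨c, hc⟩ := (IsLocalizedModule.eq_zero_iff (nonZeroDivisors A) i).1 hx
    have hreg := Module.Flat.isSMulRegular_of_nonZeroDivisors (M := F) c.2
    exact hreg (hc.trans (smul_zero _).symm)
  have hF : Module.Flat A (LinearMap.range i) := Module.Flat.of_linearEquiv (LinearEquiv.ofInjective i hi).symm
  have h1 : PD A (n+1) (V ⧸ LinearMap.range i) := by
    refine lemD n H hV _ hF ?_
    intro v
    obtain ⟨⟨x, s⟩, hx⟩ := IsLocalizedModule.surj (nonZeroDivisors A) i v
    exact ⟨s, nonZeroDivisors.ne_zero s.2, x, hx.symm⟩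
  have h2 : PD A (n+1) V := by
    let b := Module.Basis.ofVectorSpace K V
    have hli : LinearIndependent A b := b.linearIndependent.restrict_scalars (by
      intro x y hxy
      simp only [Algebra.smul_def, mul_one] at hxy
      exact IsLocalization.injective K le_rfl hxy)
    let L : Submodule A V := Submodule.span A (Set.range b)
    have hLf : Module.Free A L := Module.Free.of_basis (Module.Basis.span hli)
    have h3 : PD A (n+1) (V ⧸ L) := by
      refine lemD n H hV L inferInstance ?_
      intro v
      have hv : v ∈ Submodule.span K (Set.range b) := by rw [b.span_eq]; trivial
      induction hv using Submodule.span_induction with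
      | mem x hx => exact ⟨1, one_ne_zero, by rw [one_smul]; exact Submodule.subset_span hx⟩
      | zero => exact ⟨1, one_ne_zero, by simp⟩
      | add x y _ _ hx hy =>
        obtain ⟨s, hs, hx⟩ := hx
        obtain ⟨t, ht, hy⟩ := hy
        refine ⟨s * t, mul_ne_zero hs ht, ?_⟩
        rw [smul_add, mul_comm, mul_smul, mul_comm, mul_smul]
        exact L.add_mem (L.smul_mem _ hx) (L.smul_mem _ hy)
      | smul a x _ hx =>
        obtain ⟨s, hs, hx⟩ := hx
        obtain ⟨⟨r, t⟩, hr⟩ := IsLocalization.surj (nonZeroDivisors A) a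
        refine ⟨s * t, mul_ne_zero hs (nonZeroDivisors.ne_zero t.2), ?_⟩
        have : (s * (t : A)) • a • x = r • s • x := by
          rw [← IsScalarTower.algebraMap_smul K (s * (t:A)), ← IsScalarTower.algebraMap_smul K r,
            ← IsScalarTower.algebraMap_smul K s, smul_smul, smul_smul, map_mul]
          simp only at hr
          rw [← hr]
          congr 1
          ring
        rw [this]
        exact L.smul_mem _ hx
    exact PD.ses₂ L.subtype L.mkQ L.subtype_injective L.mkQ_surjective (LinearMap.exact_subtype_mkQ L)
      (PD.mono (by omega) (PD.one_iff.2 inferInstance)) h3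
  exact PD.ses₁ i (LinearMap.range i).mkQ hi (Submodule.mkQ_surjective _)
    (LinearMap.exact_map_mkQ_range i) h2 (PD.mono (by omega) h1)
end

lemma flat_pd (n : ℕ) : ∀ (A : Type u) [CommRing A] [IsNoetherianRing A], ringKrullDim A < n →
    ∀ (F : Type u) [AddCommGroup F] [Module A F], Module.Flat A F → PD A n F := by
  induction n with
  | zero =>
    intro A _ _ hA F _ _ _
    have hs : Subsingleton A := by
      by_contra hcon
      rw [not_subsingleton_iff_nontrivial] at hcon
      exact absurd hA (not_lt_of_ge ringKrullDim_nonneg_of_nontrivial)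
    exact PD.zero_iff.2 (Module.subsingleton A F)
  | succ n ih =>
    intro A _ _ hA F _ _ _
    refine PD.of_primes n F fun p => ?_
    have hp : ringKrullDim (A ⧸ p.asIdeal) < (n + 1 : ℕ) :=
      lt_of_le_of_lt (ringKrullDim_quotient_le _) hA
    refine flat_domain n ?_ _
    intro s hs M _ _ hM
    refine ih _ ?_ M hM
    have h1 := ringKrullDim_quotient_succ_le_of_nonZeroDivisor (mem_nonZeroDivisors_of_ne_zero hs)
    have h2 := lt_of_le_of_lt h1 hp
    revert h2
    generalize ringKrullDim ((A ⧸ p.asIdeal) ⧸ Ideal.span {s}) = D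
    intro h2
    by_contra hcon
    push Not at hcon
    have : ((n : WithBot ℕ∞)) + 1 ≤ D + 1 := by gcongr
    exact absurd h2 (not_lt_of_ge (by push_cast; exact this))


lemma hom_acyclic (A : Type u) [CommRing A] (X : ℤ → Type u) [∀ n, AddCommGroup (X n)]
    [∀ n, Module A (X n)] (d : ∀ n, X n →ₗ[A] X (n + 1)) (hproj : ∀ n, Module.Projective A (X n))
    (hd : ∀ n, Function.Exact (d n) (d (n + 1)))
    (h : ∀ (Q : Type u) [AddCommGroup Q] [Module A Q], Module.Projective A Q →
      ∀ n, Function.Exact (LinearMap.lcomp A Q (d (n + 1))) (LinearMap.lcomp A Q (d n))) (k : ℕ) :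
    ∀ (F : Type u) [AddCommGroup F] [Module A F], PD A (k+1) F →
      ∀ n, Function.Exact (LinearMap.lcomp A F (d (n + 1))) (LinearMap.lcomp A F (d n)) := by
  induction k with
  | zero => intro F _ _ hF; exact h F (PD.one_iff.1 hF)
  | succ k ih =>
    intro F _ _ hF n f
    constructor
    · intro hf
      obtain ⟨m, rfl⟩ : ∃ m, n = m + 1 := ⟨n - 1, by ring⟩
      have hf : f ∘ₗ d (m+1) = 0 := hf
      obtain ⟨f', hf'⟩ := Module.projective_lifting_property (cov A F) f cov_surj
      have hker : ∀ x, (f' ∘ₗ d (m+1)) x ∈ LinearMap.ker (cov A F) := by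
        intro x
        have h1 := LinearMap.congr_fun hf' (d (m+1) x)
        have h2 := LinearMap.congr_fun hf x
        exact h1.trans h2
      let q : X (m+1) →ₗ[A] LinearMap.ker (cov A F) := (f' ∘ₗ d (m+1)).codRestrict _ hker
      have hq : LinearMap.lcomp A (LinearMap.ker (cov A F)) (d m) q = 0 := by
        ext1 x
        apply Subtype.ext
        change f' (d (m+1) (d m x)) = 0
        rw [(hd m).apply_apply_eq_zero, map_zero]
      obtain ⟨g, hg⟩ := (ih _ (PD.syz hF) m q).1 hq
      have hc : LinearMap.lcomp A (F →₀ A) (d (m+1))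
          (f' - (LinearMap.ker (cov A F)).subtype ∘ₗ g) = 0 := by
        apply LinearMap.ext
        intro x
        have := congrArg Subtype.val (LinearMap.congr_fun hg x)
        change f' (d (m+1) x) - (g (d (m+1) x) : F →₀ A) = 0
        rw [sub_eq_zero]
        exact this.symm
      obtain ⟨l, hl⟩ := (h (F →₀ A) inferInstance (m+1) _).1 hc
      refine ⟨cov A F ∘ₗ l, ?_⟩
      ext x
      have h3 := LinearMap.congr_fun hl x
      change l (d (m+1+1) x) = f' x - (g x : F →₀ A) at h3
      change cov A F (l (d (m+1+1) x)) = f x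
      rw [h3, map_sub, (g x).2, sub_zero]
      exact LinearMap.congr_fun hf' x
    · rintro ⟨g, rfl⟩
      ext x
      change g (d (n+1) (d n x)) = 0
      rw [(hd n).apply_apply_eq_zero, map_zero]

lemma char_flat (A : Type u) [CommRing A] [IsNoetherianRing A] (I : Type u) [AddCommGroup I]
    [Module A I] (hI : Module.Injective A I) : Module.Flat A (CharacterModule I) := by
  refine Module.Flat.of_forall_isTrivialRelation ?_
  intro l a φ hφ
  -- syzygies of `a`
  let α : (Fin l → A) →ₗ[A] A := Fintype.linearCombination A a
  obtain ⟨k, b, hb⟩ := Submodule.fg_iff_exists_fin_generating_family.1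
    (IsNoetherian.noetherian (LinearMap.ker α))
  have hbk : ∀ j, ∑ i, a i * b j i = 0 := by
    intro j
    have : b j ∈ LinearMap.ker α := hb ▸ Submodule.subset_span ⟨j, rfl⟩
    have : α (b j) = 0 := this
    simpa [α, Fintype.linearCombination_apply, mul_comm] using this
  let β : (Fin l → I) →ₗ[A] (Fin k → I) :=
    LinearMap.pi fun j => ∑ i, b j i • LinearMap.proj i
  have hβ : ∀ z j, β z j = ∑ i, b j i • z i := by
    intro z j; simp [β, LinearMap.sum_apply]
  let ψ : CharacterModule (Fin l → I) := ∑ i, (φ i).comp (Pi.evalAddMonoidHom (fun _ => I) i)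
  have hψ : ∀ z, ψ z = ∑ i, φ i (z i) := by
    intro z
    exact (AddMonoidHom.finsetSum_apply _ _ _)
  -- exactness
  have hex : ∀ z, β z = 0 → ψ z = 0 := by
    intro z hz
    let ζ : (Fin l → A) →ₗ[A] I := Fintype.linearCombination A z
    have hle : LinearMap.ker α ≤ LinearMap.ker ζ := by
      rw [← hb, Submodule.span_le]
      rintro _ ⟨j, rfl⟩
      have := congrFun hz j
      rw [hβ] at this
      exact this
    let ζ' := (LinearMap.ker α).liftQ ζ hle
    let α' := (LinearMap.ker α).liftQ α le_rfl
    have hα' : Function.Injective α' := by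
      rw [← LinearMap.ker_eq_bot]
      exact Submodule.ker_liftQ_eq_bot _ _ _ le_rfl
    obtain ⟨t, ht⟩ := hI.out α' hα' ζ'
    have hz' : ∀ i, z i = a i • t 1 := by
      intro i
      have := ht ((LinearMap.ker α).mkQ (Pi.single i 1))
      have h1 : α' ((LinearMap.ker α).mkQ (Pi.single i 1)) = a i := by
        change α (Pi.single i 1) = a i
        simp [α, Fintype.linearCombination_apply_single]
      have h2 : ζ' ((LinearMap.ker α).mkQ (Pi.single i 1)) = z i := by
        change ζ (Pi.single i 1) = z i
        simp [ζ, Fintype.linearCombination_apply_single]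
      rw [h1, h2] at this
      rw [← this, ← map_smul, smul_eq_mul, mul_one]
    rw [hψ]
    have h3 := DFunLike.congr_fun hφ (t 1)
    have h4 : (∑ i, a i • φ i) (t 1) = ∑ i, φ i (a i • t 1) := AddMonoidHom.finsetSum_apply _ _ _
    rw [h4] at h3
    simp only [hz']
    exact h3
  -- extend
  let ψ' : CharacterModule ((Fin l → I) ⧸ LinearMap.ker β) :=
    QuotientAddGroup.lift (LinearMap.ker β).toAddSubgroup ψ (fun z hz => hex z hz)
  let β' := (LinearMap.ker β).liftQ β le_rfl
  have hβ' : Function.Injective β' := by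
    rw [← LinearMap.ker_eq_bot]
    exact Submodule.ker_liftQ_eq_bot _ _ _ le_rfl
  obtain ⟨χ, hχ⟩ := CharacterModule.dual_surjective_of_injective β' hβ' ψ'
  have hχ' : ∀ z, χ (β z) = ψ z := by
    intro z
    exact DFunLike.congr_fun hχ ((LinearMap.ker β).mkQ z)
  refine ⟨k, fun i j => b j i, fun j => χ.comp (AddMonoidHom.single (fun _ => I) j), ?_, hbk⟩
  intro i
  ext x
  have h5 := hχ' (Pi.single i x)
  have h6 : ψ (Pi.single i x) = φ i x := by
    rw [hψ, Finset.sum_eq_single i]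
    · simp
    · intro j _ hj; simp [Pi.single_eq_of_ne hj]
    · simp
  have h7 : β (Pi.single i x) = ∑ j, Pi.single j (b j i • x) := by
    ext j
    rw [hβ, Finset.sum_apply, Finset.sum_eq_single i, Finset.sum_eq_single j]
    · simp
    · intro j' _ hj; exact Pi.single_eq_of_ne hj.symm _
    · simp
    · intro j _ hj; simp [Pi.single_eq_of_ne hj]
    · simp
  rw [← h6, ← h5, h7, map_sum]
  have h8 : ∀ u : Fin k → CharacterModule I, (∑ j, u j) x = ∑ j, u j x :=
    fun u => AddMonoidHom.finsetSum_apply _ _ _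
  rw [h8]
  rfl

lemma tensor_exact (A : Type u) [CommRing A] {M₁ M₂ M₃ I : Type u} [AddCommGroup M₁] [Module A M₁]
    [AddCommGroup M₂] [Module A M₂] [AddCommGroup M₃] [Module A M₃] [AddCommGroup I] [Module A I]
    (f : M₁ →ₗ[A] M₂) (g : M₂ →ₗ[A] M₃) (hfg : Function.Exact f g)
    (h : Function.Exact (LinearMap.lcomp A (CharacterModule I) g)
      (LinearMap.lcomp A (CharacterModule I) f)) :
    Function.Exact (f.rTensor I) (g.rTensor I) := by
  intro z
  constructor
  · intro hz
    by_contra hcon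
    let W := LinearMap.range (f.rTensor I)
    have hne : W.mkQ z ≠ 0 := by
      rw [Submodule.mkQ_apply, Ne, Submodule.Quotient.mk_eq_zero]; exact hcon
    obtain ⟨c, hc⟩ := CharacterModule.exists_character_apply_ne_zero_of_ne_zero hne
    let c' : CharacterModule (M₂ ⊗[A] I) := CharacterModule.dual W.mkQ c
    let p : M₂ →ₗ[A] CharacterModule I := CharacterModule.curry c'
    have hp : LinearMap.lcomp A (CharacterModule I) f p = 0 := by
      apply LinearMap.ext
      intro x
      ext y
      change c (W.mkQ (f x ⊗ₜ y)) = 0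
      have : W.mkQ (f x ⊗ₜ y) = 0 := by
        rw [Submodule.mkQ_apply, Submodule.Quotient.mk_eq_zero]
        exact ⟨x ⊗ₜ y, LinearMap.rTensor_tmul ..⟩
      rw [this, map_zero]
    obtain ⟨q, hq⟩ := (h p).1 hp
    have key : ∀ w, c' w = CharacterModule.homEquiv q (g.rTensor I w) := by
      intro w
      induction w with
      | zero => rw [map_zero, map_zero, map_zero]
      | add x y hx hy => rw [map_add, map_add, map_add, hx, hy]
      | tmul m i => exact (DFunLike.congr_fun (LinearMap.congr_fun hq m) i).symm
    apply hc
    have := key z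
    rw [hz, map_zero] at this
    exact this
  · rintro ⟨w, rfl⟩
    rw [← LinearMap.comp_apply, ← LinearMap.rTensor_comp, hfg.linearMap_comp_eq_zero,
      LinearMap.rTensor_zero, LinearMap.zero_apply]


/-- Over a commutative noetherian ring of finite Krull dimension, a totally acyclic complex of
projective modules is N-totally acyclic: `P ⊗_A I` is acyclic for every injective `I`. -/
theorem totallyAcyclic_nTotallyAcyclic
    (A : Type u) [CommRing A] [IsNoetherianRing A] (hdim : ringKrullDim A < ⊤)
    (X : ℤ → Type u) [∀ n, AddCommGroup (X n)] [∀ n, Module A (X n)]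
    (d : ∀ n, X n →ₗ[A] X (n + 1)) (hproj : ∀ n, Module.Projective A (X n))
    (h : IsTotallyAcyclic A X d) :
    (∀ n, Function.Exact (d n) (d (n + 1))) ∧
    ∀ (I : Type u) [AddCommGroup I] [Module A I], Module.Injective A I →
      ∀ n, Function.Exact (LinearMap.rTensor I (d n)) (LinearMap.rTensor I (d (n + 1))) := by
  refine ⟨h.1, fun I _ _ hI n => ?_⟩
  have hfin : ∃ k : ℕ, ringKrullDim A < (k + 1 : ℕ) := by
    generalize ringKrullDim A = D at hdim
    induction D with
    | bot => exact ⟨0, WithBot.bot_lt_coe _⟩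
    | coe D =>
      induction D with
      | top => exact absurd hdim (lt_irrefl _)
      | coe m => exact ⟨m, by exact_mod_cast Nat.lt_succ_self m⟩
  obtain ⟨k, hk⟩ := hfin
  have hfl := char_flat A I hI
  exact tensor_exact A (d n) (d (n + 1)) (h.1 n)
    (hom_acyclic A X d hproj h.1 h.2 k _ (flat_pd (k + 1) A hk _ hfl) n)
end

section
/- Let A be a commutative noetherian ring and P a cochain complex of projective A-modules which is N-totally acyclic, i.e., P is acyclic and P ⊗_A I is acyclic for every injective A-module I. Then Hom_A(P, Q) is acyclic for every flat A-module Q; in particular, P is totally acyclic. -/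
universe u

namespace NTot

theorem depChoice {σ : ℕ → Type u} (R : ∀ n, σ n → σ (n+1) → Prop) (a : σ 0)
    (h : ∀ n p, ∃ q, R n p q) : ∃ f : ∀ n, σ n, f 0 = a ∧ ∀ n, R n (f n) (f (n+1)) := by
  choose nx hnx using h
  exact ⟨fun n => Nat.rec a (fun n p => nx n p) n, rfl, fun n => hnx n _⟩

theorem finHomotopy {A : Type u} [CommRing A] [IsNoetherianRing A]
    {L : ℕ → Type u} [∀ n, AddCommGroup (L n)] [∀ n, Module A (L n)]
    [∀ n, Module.Finite A (L n)]
    (d : ∀ n, L n →ₗ[A] L (n+1)) (hd : ∀ n, d (n+1) ∘ₗ d n = 0)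
    {C : ℕ → Type u} [∀ n, AddCommGroup (C n)] [∀ n, Module A (C n)]
    (δ : ∀ n, C n →ₗ[A] C (n+1)) (hδ : ∀ n, δ (n+1) ∘ₗ δ n = 0)
    (H : ∀ n (M : Type u) [AddCommGroup M] [Module A M] [Module.Finite A M]
      (f : M →ₗ[A] C (n+1)), δ (n+1) ∘ₗ f = 0 → ∃ z : M →ₗ[A] C n, δ n ∘ₗ z = f)
    (g : ∀ n, L n →ₗ[A] C n) (hg : ∀ n, g (n+1) ∘ₗ d n = δ n ∘ₗ g n)
    (hg0 : δ 0 ∘ₗ g 0 = 0) :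
    ∃ h : ∀ n, L (n+1) →ₗ[A] C n,
      ∀ n, g (n+1) = δ n ∘ₗ h n + h (n+1) ∘ₗ d (n+1) := by
  have H' : ∀ n m (f : L (m+1) →ₗ[A] C (n+1)), δ (n+1) ∘ₗ f = 0 → f ∘ₗ d m = 0 →
      ∃ z : L (m+1) →ₗ[A] C n, δ n ∘ₗ z = f ∧ z ∘ₗ d m = 0 := by
    intro n m f h1 h2
    have hle : LinearMap.range (d m) ≤ LinearMap.ker f := by
      rw [LinearMap.range_le_ker_iff]; exact h2
    obtain ⟨z, hz⟩ := H n (L (m+1) ⧸ LinearMap.range (d m))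
      ((LinearMap.range (d m)).liftQ f hle) (by
        apply Submodule.linearMap_qext
        ext x
        simpa using LinearMap.congr_fun h1 x)
    refine ⟨z ∘ₗ (LinearMap.range (d m)).mkQ, ?_, ?_⟩
    · rw [← LinearMap.comp_assoc, hz, Submodule.liftQ_mkQ]
    · rw [LinearMap.comp_assoc, LinearMap.range_mkQ_comp, LinearMap.comp_zero]
  have B : ∀ n (u : L (n+1) →ₗ[A] C (n+1)), u ∘ₗ d n = 0 →
      δ (n+1) ∘ₗ u = g (n+2) ∘ₗ d (n+1) →
      ∃ (z : L (n+1) →ₗ[A] C n) (v : L (n+2) →ₗ[A] C (n+1)), z ∘ₗ d n = 0 ∧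
        u = δ n ∘ₗ z + v ∘ₗ d (n+1) := by
    intro n u hu hδu
    obtain ⟨y, hy, hyd⟩ := H' (n+2) (n+1) (δ (n+2) ∘ₗ g (n+2))
      (by rw [← LinearMap.comp_assoc, hδ, LinearMap.zero_comp])
      (by rw [← hg, LinearMap.comp_assoc, hd, LinearMap.comp_zero])
    obtain ⟨v, hv⟩ := H (n+1) _ (g (n+2) - y) (by rw [LinearMap.comp_sub, hy, sub_self])
    obtain ⟨z, hz, hzd⟩ := H' n n (u - v ∘ₗ d (n+1))
      (by rw [LinearMap.comp_sub, ← LinearMap.comp_assoc, hv, hδu, LinearMap.sub_comp, hyd]; simp)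
      (by rw [LinearMap.sub_comp, LinearMap.comp_assoc, hd, hu]; simp)
    exact ⟨z, v, hzd, by rw [hz]; simp⟩
  let σ : ℕ → Type u := fun n => {p : (L (n+1) →ₗ[A] C n) × (L (n+2) →ₗ[A] C (n+1)) //
    g (n+1) = δ n ∘ₗ p.1 + p.2 ∘ₗ d (n+1)}
  obtain ⟨z, v, -, h0⟩ := B 0 (g 1) (by rw [hg, hg0]) (hg 1).symm
  obtain ⟨f, -, hf⟩ := depChoice (σ := σ)
    (fun n p q => g (n+1) = δ n ∘ₗ p.1.1 + q.1.1 ∘ₗ d (n+1)) ⟨(z, v), h0⟩ (by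
      rintro n ⟨⟨h, k⟩, hp⟩
      dsimp only at hp
      obtain ⟨z, v, hz, hzv⟩ := B (n+1) (g (n+2) - δ (n+1) ∘ₗ k)
        (by
          have : k ∘ₗ d (n+1) = g (n+1) - δ n ∘ₗ h := by rw [hp]; simp
          have e : δ (n+1) ∘ₗ δ n ∘ₗ h = 0 := by
            rw [← LinearMap.comp_assoc, hδ, LinearMap.zero_comp]
          rw [LinearMap.sub_comp, hg, LinearMap.comp_assoc, this, LinearMap.comp_sub, e]
          simp)
        (by rw [LinearMap.comp_sub, ← hg, ← LinearMap.comp_assoc, hδ]; simp)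
      refine ⟨⟨(k + z, v), ?_⟩, ?_⟩
      · dsimp only
        rw [LinearMap.comp_add]
        exact (sub_eq_iff_eq_add'.mp hzv).trans (add_assoc _ _ _).symm
      · dsimp only
        rw [LinearMap.add_comp, hz, add_zero, hp])
  exact ⟨fun n => (f n).1.1, hf⟩


theorem agreeOn {A X M : Type u} [CommRing A] [AddCommGroup M] [Module A M]
    (f g : (X →₀ A) →ₗ[A] M) (S : Set X)
    (h : ∀ x ∈ S, f (Finsupp.single x 1) = g (Finsupp.single x 1))
    (v : X →₀ A) (hv : (v.support : Set X) ⊆ S) : f v = g v := by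
  have h1 : v ∈ Finsupp.supported A A S := hv
  rw [Finsupp.supported_eq_span_single] at h1
  refine LinearMap.eqOn_span (f := f) (g := g) ?_ h1
  rintro _ ⟨x, hx, rfl⟩
  exact h x hx

section
variable {A : Type u} [CommRing A]
    {X : ℕ → Type u} (d : ∀ n, (X n →₀ A) →ₗ[A] (X (n+1) →₀ A))
    {C : ℕ → Type u} [∀ n, AddCommGroup (C n)] [∀ n, Module A (C n)]
    (δ : ∀ n, C n →ₗ[A] C (n+1)) (g : ∀ n, (X n →₀ A) →ₗ[A] C n)

noncomputable def err (h : ∀ n, (X (n+1) →₀ A) →ₗ[A] C n) (n : ℕ) : (X (n+1) →₀ A) →ₗ[A] C (n+1) :=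
  g (n+1) - δ n ∘ₗ h n - h (n+1) ∘ₗ d (n+1)

def clos (I : ∀ n, Set (X n)) : ∀ n, Set (X n)
  | 0 => I 0
  | n+1 => I (n+1) ∪ ⋃ y ∈ clos I n, ((d n (Finsupp.single y 1)).support : Set (X (n+1)))

def IsCl (S : ∀ n, Set (X n)) : Prop :=
  ∀ n, ∀ x ∈ S n, ((d n (Finsupp.single x 1)).support : Set (X (n+1))) ⊆ S (n+1)

theorem clos_isCl (I : ∀ n, Set (X n)) : IsCl d (clos d I) := fun n x hx =>
  Set.subset_union_of_subset_right (Set.subset_biUnion_of_mem (u := fun y =>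
    ((d n (Finsupp.single y 1)).support : Set (X (n+1)))) hx) _

theorem clos_sub (I : ∀ n, Set (X n)) (n : ℕ) : I n ⊆ clos d I n := by
  cases n
  · exact subset_rfl
  · exact Set.subset_union_left

theorem clos_fin (I : ∀ n, Set (X n)) (hI : ∀ n, (I n).Finite) (n : ℕ) :
    (clos d I n).Finite := by
  induction n with
  | zero => exact hI 0
  | succ n ih => exact (hI _).union (ih.biUnion fun y _ => Finset.finite_toSet _)

structure St where
  S : ∀ n, Set (X n)
  h : ∀ n, (X (n+1) →₀ A) →ₗ[A] C n
  cl : IsCl d S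
  z : ∀ n, ∀ x ∈ S (n+1), err d δ g h n (Finsupp.single x 1) = 0

def St.le (p q : St d δ g) : Prop :=
  (∀ n, p.S n ⊆ q.S n) ∧ ∀ n, ∀ x ∈ p.S (n+1), p.h n (Finsupp.single x 1) =
    q.h n (Finsupp.single x 1)

theorem St.le_refl (p : St d δ g) : p.le d δ g p := ⟨fun _ => subset_rfl, fun _ _ _ => rfl⟩

open Classical in
theorem St.chain (c : Set (St d δ g)) (hc : IsChain (St.le d δ g) c) :
    ∃ ub, ∀ a ∈ c, St.le d δ g a ub := by
  let H : ∀ n, X (n+1) → C n := fun n x =>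
    if hx : ∃ p ∈ c, x ∈ p.S (n+1) then hx.choose.h n (Finsupp.single x 1) else 0
  let h : ∀ n, (X (n+1) →₀ A) →ₗ[A] C n := fun n => Finsupp.linearCombination A (H n)
  have hh : ∀ p ∈ c, ∀ n, ∀ x ∈ p.S (n+1), p.h n (Finsupp.single x 1) =
      h n (Finsupp.single x 1) := by
    intro p hp n x hx
    have hex : ∃ p ∈ c, x ∈ p.S (n+1) := ⟨p, hp, hx⟩
    have e : h n (Finsupp.single x 1) = hex.choose.h n (Finsupp.single x 1) := by
      simp only [h, H, Finsupp.linearCombination_single, one_smul, dif_pos hex]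
    rw [e]
    obtain ⟨hq, hxq⟩ := hex.choose_spec
    by_cases hpq : p = hex.choose
    · rw [← hpq]
    · rcases hc hp hq hpq with h1 | h1
      · exact h1.2 n x hx
      · exact (h1.2 n x hxq).symm
  refine ⟨⟨fun n => ⋃ p ∈ c, p.S n, h, ?_, ?_⟩, ?_⟩
  · intro n x hx
    simp only [Set.mem_iUnion] at hx
    obtain ⟨p, hp, hx⟩ := hx
    exact (p.cl n x hx).trans (Set.subset_biUnion_of_mem (u := fun p : St d δ g => p.S (n+1)) hp)
  · intro n x hx
    simp only [Set.mem_iUnion] at hx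
    obtain ⟨p, hp, hx⟩ := hx
    rw [← p.z n x hx]
    simp only [err, LinearMap.sub_apply, LinearMap.comp_apply]
    rw [hh p hp n x hx, agreeOn (h (n+1)) (p.h (n+1)) (p.S (n+2))
      (fun y hy => (hh p hp (n+1) y hy).symm) _ (p.cl _ x hx)]
  · intro p hp
    exact ⟨fun n => Set.subset_biUnion_of_mem (u := fun p : St d δ g => p.S n) hp, hh p hp⟩

theorem err_comm (hd : ∀ n, d (n+1) ∘ₗ d n = 0) (hδ : ∀ n, δ (n+1) ∘ₗ δ n = 0)
    (hg : ∀ n, g (n+1) ∘ₗ d n = δ n ∘ₗ g n) (h : ∀ n, (X (n+1) →₀ A) →ₗ[A] C n) (n : ℕ) :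
    err d δ g h (n+1) ∘ₗ d (n+1) = δ (n+1) ∘ₗ err d δ g h n := by
  ext1 x
  ext1
  have h1 := fun v => LinearMap.congr_fun (hd (n+1)) v
  have h2 := fun v => LinearMap.congr_fun (hδ n) v
  have h3 := fun v => LinearMap.congr_fun (hg (n+1)) v
  simp only [LinearMap.comp_apply, LinearMap.zero_apply] at h1 h2 h3
  simp [err, h1, h2, h3]

theorem freeHomotopy [IsNoetherianRing A] (hd : ∀ n, d (n+1) ∘ₗ d n = 0)
    (hδ : ∀ n, δ (n+1) ∘ₗ δ n = 0) (hC : Subsingleton (C 0))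
    (H : ∀ n (M : Type u) [AddCommGroup M] [Module A M] [Module.Finite A M]
      (f : M →ₗ[A] C (n+1)), δ (n+1) ∘ₗ f = 0 → ∃ z : M →ₗ[A] C n, δ n ∘ₗ z = f)
    (hg : ∀ n, g (n+1) ∘ₗ d n = δ n ∘ₗ g n) :
    ∃ h : ∀ n, (X (n+1) →₀ A) →ₗ[A] C n,
      ∀ n, g (n+1) = δ n ∘ₗ h n + h (n+1) ∘ₗ d (n+1) := by
  obtain ⟨m, hm⟩ := exists_maximal_of_chains_bounded (r := St.le d δ g) (St.chain d δ g)
    (fun {p q r} h1 h2 => ⟨fun n => (h1.1 n).trans (h2.1 n), fun n x hx =>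
      (h1.2 n x hx).trans (h2.2 n x (h1.1 _ hx))⟩)
  have huniv : ∀ n x, x ∈ m.S n := by
    intro m0 x
    let I : ∀ n, Set (X n) := fun n => {y | (⟨n, y⟩ : Σ n, X n) = ⟨m0, x⟩}
    have hI : ∀ n, (I n).Finite := by
      intro n
      refine Set.Subsingleton.finite ?_
      intro y hy z hz
      have := (hy : (⟨n, y⟩ : Σ n, X n) = ⟨m0, x⟩).trans (hz : (⟨n, z⟩ : Σ n, X n) = ⟨m0, x⟩).symm
      simpa using this
    let T := clos d I
    have hT : IsCl d T := clos_isCl d I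
    have hTf : ∀ n, (T n).Finite := clos_fin d I hI
    let L : ℕ → Type u := fun n => (↥(T n \ m.S n) →₀ A)
    have : ∀ n, Finite ↥(T n \ m.S n) := fun n => (hTf n).subset Set.sdiff_subset
    have : ∀ n, Module.Finite A (L n) := fun n => by
      show Module.Finite A (↥(T n \ m.S n) →₀ A)
      infer_instance
    let i : ∀ n, L n →ₗ[A] (X n →₀ A) := fun n => Finsupp.lmapDomain A A Subtype.val
    let ρ : ∀ n, (X n →₀ A) →ₗ[A] L n := fun n => Finsupp.lsubtypeDomain (T n \ m.S n)
    have i1 : ∀ n (y : ↥(T n \ m.S n)), i n (Finsupp.single y 1) = Finsupp.single y.1 1 := by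
      intro n y
      exact Finsupp.mapDomain_single
    have ρS : ∀ n, ∀ y ∈ m.S n, ρ n (Finsupp.single y 1) = 0 := by
      intro n y hy
      ext z
      have : y ≠ z.1 := fun h => z.2.2 (h ▸ hy)
      exact Finsupp.single_eq_of_ne' this
    have ρT : ∀ n (y : ↥(T n \ m.S n)), ρ n (Finsupp.single y.1 1) = Finsupp.single y 1 := by
      classical
      intro n y
      ext z
      show (Finsupp.single y.1 1 : X n →₀ A) z.1 = _
      simp [Finsupp.single_apply, Subtype.ext_iff]
    have key : ∀ n (M : Type u) [AddCommGroup M] [Module A M] (E : (X n →₀ A) →ₗ[A] M),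
        (∀ y ∈ m.S n, E (Finsupp.single y 1) = 0) → ∀ v : X n →₀ A,
        (v.support : Set (X n)) ⊆ m.S n ∪ T n → E (i n (ρ n v)) = E v := by
      intro n M _ _ E hE v hv
      refine agreeOn (E ∘ₗ i n ∘ₗ ρ n) E _ ?_ v hv
      intro y hy
      by_cases hyS : y ∈ m.S n
      · simp [ρS n y hyS, hE y hyS]
      · have hyT : y ∈ T n \ m.S n := ⟨hy.resolve_left hyS, hyS⟩
        have := ρT n ⟨y, hyT⟩
        simp only at this
        simp [this, i1]
    have key2 : ∀ n (M : Type u) [AddCommGroup M] [Module A M] (E : (X (n+1) →₀ A) →ₗ[A] M),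
        (∀ y ∈ m.S (n+1), E (Finsupp.single y 1) = 0) →
        E ∘ₗ i (n+1) ∘ₗ ρ (n+1) ∘ₗ d n ∘ₗ i n = E ∘ₗ d n ∘ₗ i n := by
      intro n M _ _ E hE
      refine Finsupp.lhom_ext' fun y => LinearMap.ext_ring ?_
      simp only [LinearMap.comp_apply, Finsupp.lsingle_apply, i1]
      exact key _ _ E hE _ ((hT n _ y.2.1).trans Set.subset_union_right)
    let D : ∀ n, L n →ₗ[A] L (n+1) := fun n => ρ (n+1) ∘ₗ d n ∘ₗ i n
    let E : ∀ n, (X n →₀ A) →ₗ[A] C n := fun n => match n with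
      | 0 => 0
      | n+1 => err d δ g m.h n
    have hE : ∀ n, E (n+1) ∘ₗ d n = δ n ∘ₗ E n := by
      intro n
      cases n with
      | zero =>
        have e1 : g 0 = 0 := Subsingleton.elim _ _
        have e2 : m.h 0 = 0 := Subsingleton.elim _ _
        simp only [E, err, LinearMap.sub_comp, hg, LinearMap.comp_assoc, hd, e1, e2]
        simp
      | succ n => exact err_comm d δ g hd hδ hg m.h n
    have hES : ∀ n, ∀ y ∈ m.S n, E n (Finsupp.single y 1) = 0 := by
      intro n y hy
      cases n with
      | zero => rfl
      | succ n => exact m.z n y hy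
    have hρd : ∀ n, ∀ y ∈ m.S n, ρ (n+1) (d n (Finsupp.single y 1)) = 0 := by
      intro n y hy
      exact agreeOn (ρ (n+1)) 0 _ (ρS (n+1)) _ (m.cl n y hy)
    obtain ⟨h', hh'⟩ := finHomotopy D
      (by
        intro n
        have := key2 n _ (ρ (n+2) ∘ₗ d (n+1)) (hρd (n+1))
        refine Eq.trans (b := (ρ (n+2) ∘ₗ d (n+1)) ∘ₗ i (n+1) ∘ₗ ρ (n+1) ∘ₗ d n ∘ₗ i n) rfl ?_
        rw [this, LinearMap.comp_assoc, ← LinearMap.comp_assoc (i n), hd]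
        simp)
      δ hδ H (fun n => E n ∘ₗ i n)
      (by
        intro n
        refine Eq.trans (b := E (n+1) ∘ₗ i (n+1) ∘ₗ ρ (n+1) ∘ₗ d n ∘ₗ i n) rfl ?_
        rw [key2 n _ (E (n+1)) (hES (n+1)), ← LinearMap.comp_assoc, hE, LinearMap.comp_assoc])
      (by simp [E])
    have herr : ∀ n v, err d δ g (fun n => m.h n + h' n ∘ₗ ρ (n+1)) n v =
        E (n+1) v - δ n (h' n (ρ (n+1) v)) - h' (n+1) (ρ (n+2) (d (n+1) v)) := by
      intro n v
      simp [E, err]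
      abel
    let q : St d δ g := ⟨fun n => m.S n ∪ T n, fun n => m.h n + h' n ∘ₗ ρ (n+1), by
        rintro n y (hy | hy)
        · exact (m.cl n y hy).trans Set.subset_union_left
        · exact (hT n y hy).trans Set.subset_union_right, by
        intro n y hy
        rw [herr]
        by_cases hyS : y ∈ m.S (n+1)
        · simp [hES _ y hyS, ρS _ y hyS, hρd _ y hyS]
        · have hyT : y ∈ T (n+1) \ m.S (n+1) := ⟨hy.resolve_left hyS, hyS⟩
          have e1 := ρT _ ⟨y, hyT⟩
          have e2 := i1 _ ⟨y, hyT⟩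
          have e3 := LinearMap.congr_fun (hh' n) (Finsupp.single ⟨y, hyT⟩ 1)
          simp only [LinearMap.comp_apply, LinearMap.add_apply, D, e2] at e1 e3 
          rw [e1, e3]
          abel⟩
    have hmq : m.le d δ g q := ⟨fun n => Set.subset_union_left, fun n y hy => by
      simp [q, ρS _ y hy]⟩
    exact (hm q hmq).1 m0 (Or.inr (clos_sub d I m0 rfl))
  refine ⟨m.h, fun n => ?_⟩
  have : err d δ g m.h n = 0 :=
    Finsupp.lhom_ext' fun y => LinearMap.ext_ring (m.z n y (huniv _ y))
  rw [err, sub_sub, sub_eq_zero] at this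
  exact this

end

theorem projHomotopy {A : Type u} [CommRing A] [IsNoetherianRing A]
    {L : ℕ → Type u} [∀ n, AddCommGroup (L n)] [∀ n, Module A (L n)]
    (hP : ∀ n, Module.Projective A (L n))
    (d : ∀ n, L n →ₗ[A] L (n+1)) (hd : ∀ n, d (n+1) ∘ₗ d n = 0)
    {C : ℕ → Type u} [∀ n, AddCommGroup (C n)] [∀ n, Module A (C n)]
    (δ : ∀ n, C n →ₗ[A] C (n+1)) (hδ : ∀ n, δ (n+1) ∘ₗ δ n = 0)
    (hC : Subsingleton (C 0))
    (H : ∀ n (M : Type u) [AddCommGroup M] [Module A M] [Module.Finite A M]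
      (f : M →ₗ[A] C (n+1)), δ (n+1) ∘ₗ f = 0 → ∃ z : M →ₗ[A] C n, δ n ∘ₗ z = f)
    (g : ∀ n, L n →ₗ[A] C n) (hg : ∀ n, g (n+1) ∘ₗ d n = δ n ∘ₗ g n) :
    ∃ h : ∀ n, L (n+1) →ₗ[A] C n,
      ∀ n, g (n+1) = δ n ∘ₗ h n + h (n+1) ∘ₗ d (n+1) := by
  have := fun n => Module.projective_def'.mp (hP n)
  choose i hi using this
  let π : ∀ n, (L n →₀ A) →ₗ[A] L n := fun n => Finsupp.linearCombination A id
  have hπ : ∀ n v, π n (i n v) = v := fun n v => LinearMap.congr_fun (hi n) v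
  have hd' : ∀ n v, d (n+1) (d n v) = 0 := fun n v => LinearMap.congr_fun (hd n) v
  have hg' : ∀ n v, g (n+1) (d n v) = δ n (g n v) := fun n v => LinearMap.congr_fun (hg n) v
  obtain ⟨h, hh⟩ := freeHomotopy (X := L) (fun n => i (n+1) ∘ₗ d n ∘ₗ π n) δ
    (fun n => g n ∘ₗ π n)
    (fun n => LinearMap.ext fun v => by
      simp only [LinearMap.comp_apply, hπ, hd', LinearMap.zero_apply, map_zero])
    hδ hC H
    (fun n => LinearMap.ext fun v => by
      simp only [LinearMap.comp_apply, hπ, hg'])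
  refine ⟨fun n => h n ∘ₗ i (n+1), fun n => LinearMap.ext fun v => ?_⟩
  have := LinearMap.congr_fun (hh n) (i (n+1) v)
  simpa only [LinearMap.comp_apply, LinearMap.add_apply, hπ] using this


section Char
variable {A : Type u} [CommRing A]

theorem charExt {M N : Type u} [AddCommGroup M] [AddCommGroup N] [Module A M] [Module A N]
    (Θ : M →ₗ[A] N) (χ : CharacterModule M) (h : ∀ v, Θ v = 0 → χ v = 0) :
    ∃ ψ : CharacterModule N, ∀ v, ψ (Θ v) = χ v := by
  let Θ' : M →ₗ[ℤ] N := Θ.toAddMonoidHom.toIntLinearMap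
  let χ' : M →ₗ[ℤ] AddCircle (1 : ℚ) := AddMonoidHom.toIntLinearMap (χ : M →+ AddCircle (1 : ℚ))
  let j : (M ⧸ LinearMap.ker Θ') →ₗ[ℤ] N := (LinearMap.ker Θ').liftQ Θ' le_rfl
  have hj : Function.Injective j := by
    rw [← LinearMap.ker_eq_bot]
    exact Submodule.ker_liftQ_eq_bot _ _ _ le_rfl
  let c : (M ⧸ LinearMap.ker Θ') →ₗ[ℤ] AddCircle (1 : ℚ) :=
    (LinearMap.ker Θ').liftQ χ' (fun v hv => h v hv)
  obtain ⟨ψ, hψ⟩ := CharacterModule.dual_surjective_of_injective j hj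
    (c.toAddMonoidHom : CharacterModule _)
  exact ⟨ψ, fun v => DFunLike.congr_fun hψ ((LinearMap.ker Θ').mkQ v)⟩

theorem flat_char [IsNoetherianRing A] (I : Type u) [AddCommGroup I] [Module A I]
    (hI : Module.Injective A I) : Module.Flat A (CharacterModule I) := by
  refine Module.Flat.of_forall_isTrivialRelation ?_
  intro l f x hx
  let φ : (Fin l → A) →ₗ[A] A := Fintype.linearCombination A f
  obtain ⟨n, s, hs⟩ := Submodule.fg_iff_exists_fin_generating_family.mp
    (IsNoetherian.noetherian (LinearMap.ker φ))
  let Θ : (Fin l → I) →ₗ[A] (Fin n → I) :=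
    LinearMap.pi fun j => ∑ i, s j i • LinearMap.proj i
  have hΘ : ∀ v j, Θ v j = ∑ i, s j i • v i := by
    intro v j
    simp [Θ]
  let χ : CharacterModule (Fin l → I) := ∑ i, CharacterModule.dual (LinearMap.proj (R := A) i) (x i)
  have hχ : ∀ v, χ v = ∑ i, x i (v i) := by
    intro v
    exact AddMonoidHom.finsetSum_apply _ _ _
  obtain ⟨ψ, hψ⟩ := charExt Θ χ (by
    intro v hv
    let β : (Fin l → A) →ₗ[A] I := Fintype.linearCombination A v
    have hβ : LinearMap.ker φ ≤ LinearMap.ker β := by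
      rw [← hs, Submodule.span_le]
      rintro _ ⟨j, rfl⟩
      have := congrFun hv j
      rw [hΘ] at this
      simpa [β, Fintype.linearCombination_apply] using this
    obtain ⟨h, hh⟩ := hI.out ((LinearMap.ker φ).liftQ φ le_rfl)
      (by rw [← LinearMap.ker_eq_bot]; exact Submodule.ker_liftQ_eq_bot _ _ _ le_rfl)
      ((LinearMap.ker φ).liftQ β hβ)
    have hv : ∀ i, v i = f i • h 1 := by
      intro i
      have := hh ((LinearMap.ker φ).mkQ (Pi.single i 1))
      simp only [Submodule.mkQ_apply, Submodule.liftQ_apply] at this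
      simp only [φ, β, Fintype.linearCombination_apply_single, one_smul] at this
      rw [← this, ← map_smul, smul_eq_mul, mul_one]
    rw [hχ]
    have h2 := DFunLike.congr_fun hx (h 1)
    have h3 : (∑ i, f i • x i) (h 1) = ∑ i, (f i • x i) (h 1) :=
      AddMonoidHom.finsetSum_apply _ _ _
    rw [h3] at h2
    simp only [hv]
    exact h2)
  refine ⟨n, fun i j => s j i, fun j => CharacterModule.dual (LinearMap.single A (fun _ => I) j) ψ,
    ?_, ?_⟩
  · intro i
    ext w
    have h1 : χ (Pi.single i w) = x i w := by
      rw [hχ, Finset.sum_eq_single i]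
      · simp
      · intro b _ hb
        simp [hb]
      · simp
    have h3 : (∑ j, s j i • CharacterModule.dual (LinearMap.single A (fun _ => I) j) ψ) w =
        ∑ j, (s j i • CharacterModule.dual (LinearMap.single A (fun _ => I) j) ψ) w :=
      AddMonoidHom.finsetSum_apply _ _ _
    rw [h3, ← h1, ← hψ]
    have h4 : Θ (Pi.single i w) = ∑ j, Pi.single j (s j i • w) := by
      ext j
      rw [hΘ, Finset.sum_eq_single i]
      · simp
      · intro b _ hb
        simp [hb]
      · simp
    rw [h4, map_sum]
    rfl
  · intro j
    have : s j ∈ LinearMap.ker φ := hs ▸ Submodule.subset_span ⟨j, rfl⟩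
    simpa [φ, Fintype.linearCombination_apply, mul_comm] using this

theorem charHomExact {I L L' L'' : Type u} [AddCommGroup I] [Module A I]
    [AddCommGroup L] [Module A L] [AddCommGroup L'] [Module A L'] [AddCommGroup L''] [Module A L'']
    (a : L →ₗ[A] L') (b : L' →ₗ[A] L'')
    (hab : Function.Exact (LinearMap.rTensor I a) (LinearMap.rTensor I b))
    (φ : L' →ₗ[A] CharacterModule I) (hφ : φ ∘ₗ a = 0) :
    ∃ ψ : L'' →ₗ[A] CharacterModule I, φ = ψ ∘ₗ b := by
  obtain ⟨ψ, hψ⟩ := charExt (LinearMap.rTensor I b) (CharacterModule.uncurry φ) (by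
    intro v hv
    obtain ⟨w, rfl⟩ := (hab v).mp hv
    induction w using TensorProduct.induction_on with
    | zero => rw [map_zero]; exact map_zero (CharacterModule.uncurry φ)
    | tmul l y => exact DFunLike.congr_fun (LinearMap.congr_fun hφ l) y
    | add w w' h h' =>
      rw [map_add, map_add, h, h', add_zero]
      · rw [← LinearMap.comp_apply, hab.linearMap_comp_eq_zero]; rfl
      · rw [← LinearMap.comp_apply, hab.linearMap_comp_eq_zero]; rfl)
  refine ⟨CharacterModule.curry ψ, ?_⟩
  ext l y
  exact (hψ (l ⊗ₜ y)).symm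

abbrev CC (Q : Type u) [AddCommGroup Q] : Type u := CharacterModule (CharacterModule Q)

def ev (A : Type u) [CommRing A] (Q : Type u) [AddCommGroup Q] [Module A Q] : Q →ₗ[A] CC Q where
  toFun q := AddMonoidHom.eval q
  map_add' a b := by ext c; exact map_add c a b
  map_smul' r a := by ext c; rfl

variable (A) in
theorem ev_inj (Q : Type u) [AddCommGroup Q] [Module A Q] : Function.Injective (ev A Q) := by
  rw [injective_iff_map_eq_zero]
  intro q hq
  exact CharacterModule.eq_zero_of_character_apply fun c => DFunLike.congr_fun hq c

abbrev Cok (A : Type u) [CommRing A] (Q : Type u) [AddCommGroup Q] [Module A Q] : Type u :=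
  CC Q ⧸ LinearMap.range (ev A Q)

theorem flat_cok [IsNoetherianRing A] (Q : Type u) [AddCommGroup Q] [Module A Q]
    (hQ : Module.Flat A Q) : Module.Flat A (Cok A Q) := by
  have h1 := Module.Flat.iff_characterModule_injective.mp hQ
  have h2 := Module.Flat.iff_characterModule_injective.mp (flat_char _ h1)
  rw [Module.Flat.iff_characterModule_injective]
  refine ⟨?_⟩
  intro X Y _ _ _ _ f hf g
  let m : CharacterModule (Cok A Q) →ₗ[A] CharacterModule (CC Q) :=
    CharacterModule.dual (LinearMap.range (ev A Q)).mkQ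
  have hm : Function.Injective m :=
    CharacterModule.dual_injective_of_surjective _ (Submodule.mkQ_surjective _)
  obtain ⟨h, hh⟩ := h2.out f hf (m ∘ₗ g)
  let e : CharacterModule (CC Q) →ₗ[A] CharacterModule Q := CharacterModule.dual (ev A Q)
  let h' : Y →ₗ[A] CharacterModule (CC Q) := h - ev A (CharacterModule Q) ∘ₗ e ∘ₗ h
  have hr : ∀ y, h' y ∈ LinearMap.range m := by
    intro y
    obtain ⟨ψ, hψ⟩ := charExt (LinearMap.range (ev A Q)).mkQ (h' y) (by
      intro v hv
      rw [Submodule.mkQ_apply, Submodule.Quotient.mk_eq_zero] at hv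
      obtain ⟨q, rfl⟩ := hv
      exact sub_self _)
    exact ⟨ψ, DFunLike.ext _ _ hψ⟩
  refine ⟨(LinearEquiv.ofInjective m hm).symm.toLinearMap ∘ₗ h'.codRestrict _ hr, ?_⟩
  intro x
  simp only [LinearMap.comp_apply, LinearEquiv.coe_coe]
  rw [LinearEquiv.symm_apply_eq]
  apply Subtype.ext
  rw [LinearMap.codRestrict_apply, LinearEquiv.ofInjective_apply]
  have h3 : e (m (g x)) = 0 := by
    ext q
    have : (LinearMap.range (ev A Q)).mkQ (ev A Q q) = 0 := by
      rw [Submodule.mkQ_apply, Submodule.Quotient.mk_eq_zero]; exact ⟨q, rfl⟩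
    show (g x) ((LinearMap.range (ev A Q)).mkQ (ev A Q q)) = 0
    rw [this]; exact map_zero (g x)
  simp only [h', LinearMap.sub_apply, LinearMap.comp_apply, hh, h3, map_zero, sub_zero]

theorem cok_lift [IsNoetherianRing A] (Q : Type u) [AddCommGroup Q] [Module A Q]
    (hQ : Module.Flat A Q) (M : Type u) [AddCommGroup M] [Module A M] [Module.Finite A M]
    (f : M →ₗ[A] Cok A Q) : ∃ z : M →ₗ[A] CC Q, (LinearMap.range (ev A Q)).mkQ ∘ₗ z = f := by
  have := flat_cok Q hQ
  have := Module.finitePresentation_of_finite A M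
  obtain ⟨k, a, b, rfl⟩ := Module.Flat.exists_factorization_of_finitePresentation f
  obtain ⟨c, hc⟩ := Module.projective_lifting_property (LinearMap.range (ev A Q)).mkQ b
    (Submodule.mkQ_surjective _)
  exact ⟨c ∘ₗ a, by rw [← LinearMap.comp_assoc, hc]⟩

theorem ev_lift (Q : Type u) [AddCommGroup Q] [Module A Q]
    (M : Type u) [AddCommGroup M] [Module A M] 
    (f : M →ₗ[A] CC Q) (hf : ev A (Cok A Q) ∘ₗ (LinearMap.range (ev A Q)).mkQ ∘ₗ f = 0) :
    ∃ z : M →ₗ[A] Q, ev A Q ∘ₗ z = f := by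
  have hr : ∀ y, f y ∈ LinearMap.range (ev A Q) := by
    intro y
    have h1 : ev A (Cok A Q) ((LinearMap.range (ev A Q)).mkQ (f y)) = 0 := LinearMap.congr_fun hf y
    rw [map_eq_zero_iff _ (ev_inj A _), Submodule.mkQ_apply, Submodule.Quotient.mk_eq_zero] at h1
    exact h1
  refine ⟨(LinearEquiv.ofInjective _ (ev_inj A Q)).symm.toLinearMap ∘ₗ f.codRestrict _ hr, ?_⟩
  ext1 y
  have := (LinearEquiv.ofInjective _ (ev_inj A Q)).apply_symm_apply (f.codRestrict _ hr y)
  exact congrArg Subtype.val this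

noncomputable def Gs (Q : ModuleCat.{u} A) : ℕ → ModuleCat.{u} A
  | 0 => Q
  | n+1 => ModuleCat.of A (Cok A (Gs Q n))

theorem Gs_flat [IsNoetherianRing A] (Q : ModuleCat.{u} A) (hQ : Module.Flat A Q) (n : ℕ) :
    Module.Flat A (Gs Q n) := by
  induction n with
  | zero => exact hQ
  | succ n ih => exact flat_cok _ ih

noncomputable def Cs (Q : ModuleCat.{u} A) : ℕ → ModuleCat.{u} A
  | 0 => ModuleCat.of A PUnit
  | 1 => Q
  | n+2 => ModuleCat.of A (CC (Gs Q n))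

noncomputable def dl (Q : ModuleCat.{u} A) : ∀ n, Cs Q n →ₗ[A] Cs Q (n+1)
  | 0 => 0
  | 1 => ev A Q
  | n+2 => ev A (Cok A (Gs Q n)) ∘ₗ (LinearMap.range (ev A (Gs Q n))).mkQ

theorem dl_dl (Q : ModuleCat.{u} A) (n : ℕ) : dl Q (n+1) ∘ₗ dl Q n = 0 := by
  have key : ∀ (P : Type u) [AddCommGroup P] [Module A P],
    (ev A (Cok A P) ∘ₗ (LinearMap.range (ev A P)).mkQ) ∘ₗ ev A P = 0 := by
    intro P _ _
    rw [LinearMap.comp_assoc, LinearMap.range_mkQ_comp, LinearMap.comp_zero]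
  match n with
  | 0 => exact LinearMap.comp_zero _
  | 1 => exact key Q
  | n+2 =>
    refine (LinearMap.comp_assoc _ _ _).symm.trans ?_
    exact (congrArg (· ∘ₗ (LinearMap.range (ev A (Gs Q n))).mkQ) (key (Cok A (Gs Q n)))).trans
      (LinearMap.zero_comp _)

theorem dl_lift [IsNoetherianRing A] (Q : ModuleCat.{u} A) (hQ : Module.Flat A Q) (n : ℕ)
    (M : Type u) [AddCommGroup M] [Module A M] [Module.Finite A M]
    (f : M →ₗ[A] Cs Q (n+1)) (hf : dl Q (n+1) ∘ₗ f = 0) :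
    ∃ z : M →ₗ[A] Cs Q n, dl Q n ∘ₗ z = f := by
  match n, f, hf with
  | 0, f, hf =>
    refine ⟨0, ?_⟩
    ext1 y
    have h1 : ev A Q (f y) = ev A Q 0 := (LinearMap.congr_fun hf y).trans (map_zero (ev A Q)).symm
    have h2 := ev_inj A Q h1
    rw [LinearMap.comp_zero]
    exact h2.symm
  | 1, f, hf =>
    let f' : M →ₗ[A] CC Q := f
    have h1 : ∃ z : M →ₗ[A] Q, ev A Q ∘ₗ z = f' := ev_lift Q M f' hf
    exact h1
  | n+2, f, hf =>
    let f' : M →ₗ[A] CC (Cok A (Gs Q n)) := f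
    have h1 : ∃ z : M →ₗ[A] Cok A (Gs Q n), ev A (Cok A (Gs Q n)) ∘ₗ z = f' :=
      ev_lift (Cok A (Gs Q n)) M f' hf
    obtain ⟨w, hw⟩ := h1
    obtain ⟨z, hz⟩ := cok_lift (Gs Q n) (Gs_flat Q hQ n) M w
    refine ⟨z, ?_⟩
    refine Eq.trans ?_ hw
    rw [← hz]
    rfl

end Char

def idx (n : ℤ) : ℕ → ℤ
  | 0 => n
  | j+1 => idx n j + 1

end NTot

/-- Over a commutative noetherian ring, an N-totally acyclic complex of projective modules `P`
has `Hom_A(P, Q)` acyclic for every flat module `Q`; in particular `P` is totally acyclic. -/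
theorem nTotallyAcyclic_hom_flat_acyclic_and_totallyAcyclic
    (A : Type u) [CommRing A] [IsNoetherianRing A]
    (X : ℤ → Type u) [∀ n, AddCommGroup (X n)] [∀ n, Module A (X n)]
    (d : ∀ n, X n →ₗ[A] X (n + 1)) (hproj : ∀ n, Module.Projective A (X n))
    (hac : ∀ n, Function.Exact (d n) (d (n + 1)))
    (htensor : ∀ (I : Type u) [AddCommGroup I] [Module A I], Module.Injective A I →
      ∀ n, Function.Exact (LinearMap.rTensor I (d n)) (LinearMap.rTensor I (d (n + 1)))) :
    (∀ (Q : Type u) [AddCommGroup Q] [Module A Q], Module.Flat A Q →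
      ∀ n, Function.Exact (LinearMap.lcomp A Q (d (n + 1))) (LinearMap.lcomp A Q (d n))) ∧
    IsTotallyAcyclic A X d := by
  have main : ∀ (Q : Type u) [AddCommGroup Q] [Module A Q], Module.Flat A Q →
      ∀ n, Function.Exact (LinearMap.lcomp A Q (d (n + 1))) (LinearMap.lcomp A Q (d n)) := by
    intro Q _ _ hQ n φ
    have hdd : ∀ n, d (n+1) ∘ₗ d n = 0 := fun n => (hac n).linearMap_comp_eq_zero
    constructor
    swap
    · rintro ⟨ψ, rfl⟩
      show (ψ ∘ₗ d (n+1)) ∘ₗ d n = 0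
      rw [LinearMap.comp_assoc, hdd, LinearMap.comp_zero]
    intro hφ
    replace hφ : φ ∘ₗ d n = 0 := hφ
    let Q' := ModuleCat.of A Q
    have hQ' : Module.Flat A Q' := hQ
    let L : ℕ → Type u := fun j => X (NTot.idx n j)
    let D : ∀ j, L j →ₗ[A] L (j+1) := fun j => d (NTot.idx n j)
    have hDD : ∀ j, D (j+1) ∘ₗ D j = 0 := fun j => hdd _
    have ext : ∀ j (ψ : L (j+1) →ₗ[A] NTot.Cs Q' (j+2)), ψ ∘ₗ D j = 0 →
        ∃ ψ' : L (j+2) →ₗ[A] NTot.Cs Q' (j+2), ψ = ψ' ∘ₗ D (j+1) := by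
      intro j ψ hψ
      exact NTot.charHomExact (I := CharacterModule (NTot.Gs Q' j)) (D j) (D (j+1))
        (htensor _ (Module.Flat.iff_characterModule_injective.mp (NTot.Gs_flat Q' hQ' j)) _) ψ hψ
    let σ : ℕ → Type u := fun j =>
      {g : L (j+1) →ₗ[A] NTot.Cs Q' (j+1) // NTot.dl Q' (j+1) ∘ₗ g ∘ₗ D j = 0}
    obtain ⟨g, hg0, hg⟩ := NTot.depChoice (σ := σ)
      (fun j p q => q.1 ∘ₗ D (j+1) = NTot.dl Q' (j+1) ∘ₗ p.1)
      ⟨φ, (congrArg (NTot.dl Q' 1 ∘ₗ ·) hφ).trans (LinearMap.comp_zero _)⟩ (by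
        rintro j ⟨p, hp⟩
        obtain ⟨q, hq⟩ := ext j (NTot.dl Q' (j+1) ∘ₗ p) hp
        refine ⟨⟨q, ?_⟩, hq.symm⟩
        rw [← hq, ← LinearMap.comp_assoc, NTot.dl_dl, LinearMap.zero_comp])
    let G : ∀ j, L j →ₗ[A] NTot.Cs Q' j := fun j => match j with
      | 0 => 0
      | j+1 => (g j).1
    obtain ⟨h, hh⟩ := NTot.projHomotopy (L := L) (fun j => hproj _) D hDD (NTot.dl Q')
      (NTot.dl_dl Q') (inferInstanceAs (Subsingleton PUnit))
      (fun n M _ _ _ f hf => NTot.dl_lift Q' hQ' n M f hf) G (by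
        intro j
        match j with
        | 0 =>
          show (g 0).1 ∘ₗ D 0 = NTot.dl Q' 0 ∘ₗ 0
          rw [hg0]
          exact hφ.trans (LinearMap.comp_zero _).symm
        | j+1 => exact hg j)
    refine ⟨h 1, ?_⟩
    have h1 : (g 0).1 = NTot.dl Q' 0 ∘ₗ h 0 + h 1 ∘ₗ D 1 := hh 0
    have h2 : NTot.dl Q' 0 ∘ₗ h 0 = 0 := LinearMap.zero_comp _
    rw [h2] at h1
    have h3 : (g 0).1 = φ := congrArg Subtype.val hg0
    exact (h3.symm.trans (h1.trans (zero_add _))).symm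
  exact ⟨main, hac, fun Q _ _ hQ => main Q (Module.Flat.of_projective)⟩
end
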